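/- arXiv:0707.4632 — 8 statements merged into one kernel-verified Lean document; each statement's English description precedes it below -/
import Mathlib

section
/- Let q : ℝ → ℝ be continuous and λ₀ ∈ ℂ. Let u, v : ℝ → ℂ be twice continuously differentiable functions with −u''(x) + q(x)·u(x) = λ₀·u(x) and −v''(x) + q(x)·v(x) = λ₀·v(x) + u(x) for all x ∈ ℝ. Assume W(u,v)(x) → 0 as x → +∞ and that x ↦ u(x)² is integrable on (0,∞). Then W(u,v)(0) = ∫_0^∞ u(x)² dx. -/
open MeasureTheory Filter

/-- The derivative of the Wronskian `u * v' - u' * v` of two `C²` functions. -/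
theorem hasDerivAt_wronskian {u v : ℝ → ℂ} (hu : ContDiff ℝ 2 u) (hv : ContDiff ℝ 2 v) (x : ℝ) :
    HasDerivAt (fun x => u x * deriv v x - deriv u x * v x)
      (u x * deriv (deriv v) x - deriv (deriv u) x * v x) x := by
  have hasDerivAt_of_contDiff {f : ℝ → ℂ} (hf : ContDiff ℝ 2 f) :
      HasDerivAt f (deriv f x) x ∧ HasDerivAt (deriv f) (deriv (deriv f) x) x :=
    ⟨(hf.differentiable (by norm_num) x).hasDerivAt,
      (hf.differentiable_deriv_two x).hasDerivAt⟩
  obtain ⟨hu₁, hu₂⟩ := hasDerivAt_of_contDiff hu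
  obtain ⟨hv₁, hv₂⟩ := hasDerivAt_of_contDiff hv
  exact ((hu₁.mul hv₂).sub (hu₂.mul hv₁)).congr_deriv (by ring)

/-- Formula (D.2): the norming integral of a solution `u` of the Schrödinger equation
expressed through the Wronskian of `u` with the derivative `v` of the solution family
with respect to the spectral parameter. -/
theorem wronskian_eq_norming_integral
    (q : ℝ → ℝ) (hq : Continuous q) (lam₀ : ℂ) (u v : ℝ → ℂ)
    (hu : ContDiff ℝ 2 u) (hv : ContDiff ℝ 2 v)
    (hueq : ∀ x : ℝ, -(deriv (deriv u) x) + (q x : ℂ) * u x = lam₀ * u x)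
    (hveq : ∀ x : ℝ, -(deriv (deriv v) x) + (q x : ℂ) * v x = lam₀ * v x + u x)
    (hW : Tendsto (fun x => u x * deriv v x - deriv u x * v x) atTop (nhds (0 : ℂ)))
    (hint : IntegrableOn (fun x => u x ^ 2) (Set.Ioi (0 : ℝ))) :
    u 0 * deriv v 0 - deriv u 0 * v 0 = ∫ x in Set.Ioi (0 : ℝ), u x ^ 2 := by
  have hderiv (x : ℝ) :
      HasDerivAt (fun x => u x * deriv v x - deriv u x * v x) (-(u x ^ 2)) x :=
    (hasDerivAt_wronskian hu hv x).congr_deriv (by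
      linear_combination v x * hueq x - u x * hveq x)
  have hftc := integral_Ioi_of_hasDerivAt_of_tendsto' (fun x _ => hderiv x) hint.neg hW
  rw [integral_neg, zero_sub] at hftc
  exact (neg_injective hftc).symm
end

section
/- Let q : ℝ → ℝ be continuous and λ₀ ∈ ℝ. Let φ₊, φ₋ : ℝ → ℝ be twice continuously differentiable real-valued solutions of −y'' + q·y = λ₀·y, neither identically zero, with φ₊(x) = c₊·φ₋(x) and φ₋(x) = c₋·φ₊(x) for all x, where c₊, c₋ are real constants with c₊·c₋ = 1, and assume x ↦ φ₊(x)² is integrable on ℝ. Let v₊, v₋ : ℝ → ℝ be twice continuously differentiable with −v₊'' + q·v₊ = λ₀·v₊ + φ₊ and −v₋'' + q·v₋ = λ₀·v₋ + φ₋, and suppose W(φ₊, v₊)(x) → 0 as x → +∞ and W(φ₋, v₋)(x) → 0 as x → −∞. Then the function x ↦ W(v₋, φ₊)(x) + W(φ₋, v₊)(x) is constant; denoting its value by Ẇ and setting (γ₊)⁻² = ∫_ℝ φ₊(x)² dx and (γ₋)⁻² = ∫_ℝ φ₋(x)² dx, one has (γ₊)⁻² = c₊·Ẇ and (γ₋)⁻²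 = c₋·Ẇ, and in particular Ẇ² = (γ₊)⁻²·(γ₋)⁻². -/
open MeasureTheory Filter

/-- If `-φ'' + q φ = μ φ` and `-v'' + q v = μ v + φ`, then `W(φ, v)' = -φ²`. -/
theorem hasDerivAt_wronskian_of_inhomogeneous {q φ v : ℝ → ℝ} {μ : ℝ}
    (hφ : ContDiff ℝ 2 φ) (hv : ContDiff ℝ 2 v)
    (hφeq : ∀ x, -(deriv (deriv φ) x) + q x * φ x = μ * φ x)
    (hveq : ∀ x, -(deriv (deriv v) x) + q x * v x = μ * v x + φ x) (x : ℝ) :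
    HasDerivAt (fun x => φ x * deriv v x - deriv φ x * v x) (-(φ x ^ 2)) x := by
  have hasDerivAt_of_contDiff {f : ℝ → ℝ} (hf : ContDiff ℝ 2 f) :
      HasDerivAt f (deriv f x) x ∧ HasDerivAt (deriv f) (deriv (deriv f) x) x :=
    ⟨(hf.differentiable (by norm_num) x).hasDerivAt,
      (hf.differentiable_deriv_two x).hasDerivAt⟩
  obtain ⟨hφ₁, hφ₂⟩ := hasDerivAt_of_contDiff hφ
  obtain ⟨hv₁, hv₂⟩ := hasDerivAt_of_contDiff hv
  refine ((hφ₁.mul hv₂).sub (hφ₂.mul hv₁)).congr_deriv ?_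
  linear_combination v x * hφeq x - φ x * hveq x

/-- Formulas (2.11) and (D.3): at an eigenvalue `lam₀`, where the Jost-type solutions
`φp`, `φm` are proportional (`φp = cp·φm`, `φm = cm·φp`, `cp·cm = 1`), the derivative
`Ẇ` of the Wronskian with respect to the spectral parameter (expressed through the
parameter-derivatives `vp`, `vm` of the solutions) satisfies
`(γ₊)⁻² = cp·Ẇ`, `(γ₋)⁻² = cm·Ẇ`, and `Ẇ² = (γ₊)⁻²·(γ₋)⁻²`. -/
theorem norming_constants_eq_wronskian_derivative
    (q : ℝ → ℝ) (hq : Continuous q) (lam₀ : ℝ)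
    (φp φm : ℝ → ℝ) (hφp : ContDiff ℝ 2 φp) (hφm : ContDiff ℝ 2 φm)
    (heqp : ∀ x : ℝ, -(deriv (deriv φp) x) + q x * φp x = lam₀ * φp x)
    (heqm : ∀ x : ℝ, -(deriv (deriv φm) x) + q x * φm x = lam₀ * φm x)
    (hφp0 : ∃ x, φp x ≠ 0) (hφm0 : ∃ x, φm x ≠ 0)
    (cp cm : ℝ) (hc : cp * cm = 1)
    (hprop1 : ∀ x, φp x = cp * φm x) (hprop2 : ∀ x, φm x = cm * φp x)
    (hint : Integrable (fun x => φp x ^ 2))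
    (vp vm : ℝ → ℝ) (hvp : ContDiff ℝ 2 vp) (hvm : ContDiff ℝ 2 vm)
    (hveqp : ∀ x : ℝ, -(deriv (deriv vp) x) + q x * vp x = lam₀ * vp x + φp x)
    (hveqm : ∀ x : ℝ, -(deriv (deriv vm) x) + q x * vm x = lam₀ * vm x + φm x)
    (hWp : Tendsto (fun x => φp x * deriv vp x - deriv φp x * vp x) atTop (nhds (0 : ℝ)))
    (hWm : Tendsto (fun x => φm x * deriv vm x - deriv φm x * vm x) atBot (nhds (0 : ℝ))) :
    ∃ Wdot : ℝ,
      (∀ x : ℝ, (vm x * deriv φp x - deriv vm x * φp x)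
          + (φm x * deriv vp x - deriv φm x * vp x) = Wdot) ∧
      (∫ x : ℝ, φp x ^ 2) = cp * Wdot ∧
      (∫ x : ℝ, φm x ^ 2) = cm * Wdot ∧
      Wdot ^ 2 = (∫ x : ℝ, φp x ^ 2) * (∫ x : ℝ, φm x ^ 2) := by
  have hderiv (x : ℝ) : deriv φp x = cp * deriv φm x := by
    rw [funext hprop1]
    exact deriv_const_mul _ (hφm.differentiable (by norm_num) x)
  have hsq : (fun x => φm x ^ 2) = fun x => cm ^ 2 * φp x ^ 2 := by
    funext x
    rw [hprop2 x, mul_pow]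
  have hintm : Integrable (fun x => φm x ^ 2) := hsq ▸ hint.const_mul (cm ^ 2)
  have hIoi (x : ℝ) := integral_Ioi_of_hasDerivAt_of_tendsto' (a := x)
    (fun y _ => hasDerivAt_wronskian_of_inhomogeneous hφp hvp heqp hveqp y)
    hint.neg.integrableOn hWp
  have hIic (x : ℝ) := integral_Iic_of_hasDerivAt_of_tendsto' (a := x)
    (fun y _ => hasDerivAt_wronskian_of_inhomogeneous hφm hvm heqm hveqm y)
    hintm.neg.integrableOn hWm
  have hnorm : (∫ x : ℝ, φm x ^ 2) = cm ^ 2 * ∫ x : ℝ, φp x ^ 2 := by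
    rw [hsq, integral_const_mul]
  refine ⟨cm * ∫ x : ℝ, φp x ^ 2, fun x => ?_, ?_, ?_, ?_⟩
  · have hsplit := intervalIntegral.integral_Iic_add_Ioi (b := x)
      hint.integrableOn hint.integrableOn
    have hp := hIoi x
    have hm := hIic x
    rw [integral_neg] at hp hm
    rw [hsq, integral_const_mul] at hm
    rw [← hsplit]
    have hp' := hprop1 x
    have hm' := hprop2 x
    have hd := hderiv x
    have hdm : deriv φm x = cm * deriv φp x := by
      rw [hd]
      linear_combination -deriv φm x * hc
    generalize (∫ y in Set.Iic x, φp y ^ 2) = A at *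
    generalize (∫ y in Set.Ioi x, φp y ^ 2) = B at *
    linear_combination vm x * hd - deriv vm x * hp' + deriv vp x * hm' - vp x * hdm
      + cm * hp + cp * hm + cm * A * hc
  · linear_combination -(∫ x : ℝ, φp x ^ 2) * hc
  · rw [hnorm]
    ring
  · rw [hnorm]
    ring
end

section
/- Assume φ₋ is real-valued, W(φ₊, conj(φ₊)) ≠ 0 and W(φ₋, φ₊) ≠ 0. Then T₊/conj(T₊) = R₊. -/
open MeasureTheory Filter

/-- The Wronskian `W(f,g)(x) = f(x)·g'(x) − f'(x)·g(x)`. -/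
noncomputable def Wr (f g : ℝ → ℂ) (x : ℝ) : ℂ := f x * deriv g x - deriv f x * g x

/-- The pointwise complex conjugate of a function `ℝ → ℂ`. -/
noncomputable def cconj (f : ℝ → ℂ) : ℝ → ℂ := fun x => starRingEnd ℂ (f x)

theorem deriv_cconj (f : ℝ → ℂ) (x : ℝ) :
    deriv (cconj f) x = starRingEnd ℂ (deriv f x) :=
  deriv.star

theorem cconj_cconj (f : ℝ → ℂ) : cconj (cconj f) = f :=
  funext fun x => Complex.conj_conj (f x)

theorem Wr_antisymm (f g : ℝ → ℂ) (x : ℝ) : Wr f g x = -Wr g f x := by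
  simp only [Wr]
  ring

/-- Conjugation commutes with the Wronskian. -/
theorem conj_Wr (f g : ℝ → ℂ) (x : ℝ) :
    starRingEnd ℂ (Wr f g x) = Wr (cconj f) (cconj g) x := by
  simp only [Wr, deriv_cconj, map_sub, map_mul]
  rfl

/-- Property I(b) of Lemma 2.3: if `φ₋` is real-valued (spectrum of multiplicity one)
then `T₊/conj(T₊) = R₊`, where `T₊ = W(conj φ₊, φ₊)/W(φ₋, φ₊)` and
`R₊ = −W(φ₋, conj φ₊)/W(φ₋, φ₊)`. -/
theorem transmission_reflection_multiplicity_one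
    (q : ℝ → ℝ) (hq : Continuous q) (lam : ℝ) (φp φm : ℝ → ℂ)
    (hφp : ContDiff ℝ 2 φp) (hφm : ContDiff ℝ 2 φm)
    (heqp : ∀ x : ℝ, -(deriv (deriv φp) x) + (q x : ℂ) * φp x = (lam : ℂ) * φp x)
    (heqm : ∀ x : ℝ, -(deriv (deriv φm) x) + (q x : ℂ) * φm x = (lam : ℂ) * φm x)
    (hreal : ∀ x : ℝ, starRingEnd ℂ (φm x) = φm x)
    (h1 : Wr φp (cconj φp) 0 ≠ 0) (h2 : Wr φm φp 0 ≠ 0) :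
    (Wr (cconj φp) φp 0 / Wr φm φp 0)
        / starRingEnd ℂ (Wr (cconj φp) φp 0 / Wr φm φp 0)
      = -(Wr φm (cconj φp) 0 / Wr φm φp 0) := by
  have hm : cconj φm = φm := funext hreal
  have hB : starRingEnd ℂ (Wr φm φp 0) ≠ 0 := (map_ne_zero _).mpr h2
  rw [map_div₀, conj_Wr (cconj φp) φp, cconj_cconj, Wr_antisymm (cconj φp) φp]
  rw [conj_Wr, hm] at hB
  rw [conj_Wr, hm]
  field_simp
end

section
/- Assume W(φ₊, conj(φ₊)) = 1/g₊ and W(φ₋, conj(φ₋)) = −1/g₋ for nonzero purely imaginary numbers g₊, g₋ (that is, Re(g₊) = Re(g₋) = 0), and assume W(φ₋, φ₊) ≠ 0. Then the consistency conditions conj(R₊)·T₊ + R₋·conj(T₊) = 0 and conj(R₋)·T₋ + R₊·conj(T₋) = 0 hold. -/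
open MeasureTheory Filter

theorem Wr_swap (f g : ℝ → ℂ) (x : ℝ) : Wr g f x = -Wr f g x := by
  simp only [Wr]
  ring

/-- The consistency condition between the scattering coefficients of `f` and `g`. -/
theorem scattering_consistency (f g : ℝ → ℂ) (x : ℝ) :
    starRingEnd ℂ (-(Wr g (cconj f) x / Wr g f x)) * (Wr (cconj f) f x / Wr g f x)
      + (-(Wr f (cconj g) x / Wr f g x)) * starRingEnd ℂ (Wr (cconj f) f x / Wr g f x) = 0 := by
  simp only [map_neg, map_div₀, conj_Wr, cconj_cconj]
  rw [Wr_swap g f, Wr_swap f (cconj g), Wr_swap f (cconj f)]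
  ring

/-- Property I(e) of Lemma 2.3, the consistency conditions
`conj(R₊)·T₊ + R₋·conj(T₊) = 0` and `conj(R₋)·T₋ + R₊·conj(T₋) = 0` on the
two-sided part of the spectrum, where the boundary values `g₊`, `g₋` of the
Herglotz functions are purely imaginary. -/
theorem consistency_conditions
    (q : ℝ → ℝ) (hq : Continuous q) (lam : ℝ) (φp φm : ℝ → ℂ)
    (hφp : ContDiff ℝ 2 φp) (hφm : ContDiff ℝ 2 φm)
    (heqp : ∀ x : ℝ, -(deriv (deriv φp) x) + (q x : ℂ) * φp x = (lam : ℂ) * φp x)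
    (heqm : ∀ x : ℝ, -(deriv (deriv φm) x) + (q x : ℂ) * φm x = (lam : ℂ) * φm x)
    (gp gm : ℂ) (hgp : gp ≠ 0) (hgm : gm ≠ 0)
    (hgpim : gp.re = 0) (hgmim : gm.re = 0)
    (h1 : Wr φp (cconj φp) 0 = 1 / gp)
    (h2 : Wr φm (cconj φm) 0 = -(1 / gm))
    (h3 : Wr φm φp 0 ≠ 0) :
    starRingEnd ℂ (-(Wr φm (cconj φp) 0 / Wr φm φp 0))
          * (Wr (cconj φp) φp 0 / Wr φm φp 0)
        + (-(Wr φp (cconj φm) 0 / Wr φp φm 0))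
          * starRingEnd ℂ (Wr (cconj φp) φp 0 / Wr φm φp 0) = 0 ∧
    starRingEnd ℂ (-(Wr φp (cconj φm) 0 / Wr φp φm 0))
          * (Wr (cconj φm) φm 0 / Wr φp φm 0)
        + (-(Wr φm (cconj φp) 0 / Wr φm φp 0))
          * starRingEnd ℂ (Wr (cconj φm) φm 0 / Wr φp φm 0) = 0 := by
  exact ⟨scattering_consistency φp φm 0, scattering_consistency φm φp 0⟩
end

section
/- Let q : ℝ → ℝ be continuous and λ ∈ ℝ, and let φ₊, φ₋ : ℝ → ℂ be twice continuously differentiable solutions of −y'' + q·y = λ·y. Suppose W(φ₊, conj(φ₊)) = 1/(i·a₊) and W(φ₋, conj(φ₋)) = −1/(i·a₋) for real numbers a₊ > 0 and a₋ > 0. Then W(φ₋, φ₊) ≠ 0, i.e. φ₊ and φ₋ are linearly independent. -/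
open MeasureTheory Filter

/-- If `W(g, f)` vanishes at `x`, then `W(f, conj f)` and `W(g, conj g)` at `x` are in the ratio
`|f|² : |g|²`. -/
theorem normSq_mul_Wr_cconj {f g : ℝ → ℂ} {x : ℝ} (h : Wr g f x = 0) :
    (Complex.normSq (g x) : ℂ) * Wr f (cconj f) x =
      (Complex.normSq (f x) : ℂ) * Wr g (cconj g) x := by
  have hc := congrArg (starRingEnd ℂ) h
  simp only [Wr, map_sub, map_mul, map_zero] at h hc
  simp only [Wr, deriv_cconj, cconj, ← Complex.mul_conj]
  linear_combination f x * g x * hc -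
    starRingEnd ℂ (f x) * starRingEnd ℂ (g x) * h

/-- Lemma 2.2, interior of `σ⁽²⁾`: if `W(φ₊, conj φ₊) = 1/(i·a₊)` and
`W(φ₋, conj φ₋) = −1/(i·a₋)` with `a₊, a₋ > 0`, then the Jost solutions `φ₊`, `φ₋`
are linearly independent, i.e. `W(φ₋, φ₊) ≠ 0`. -/
theorem wronskian_nonzero_interior_sigma2
    (q : ℝ → ℝ) (hq : Continuous q) (lam : ℝ) (φp φm : ℝ → ℂ)
    (hφp : ContDiff ℝ 2 φp) (hφm : ContDiff ℝ 2 φm)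
    (heqp : ∀ x : ℝ, -(deriv (deriv φp) x) + (q x : ℂ) * φp x = (lam : ℂ) * φp x)
    (heqm : ∀ x : ℝ, -(deriv (deriv φm) x) + (q x : ℂ) * φm x = (lam : ℂ) * φm x)
    (ap am : ℝ) (hap : 0 < ap) (ham : 0 < am)
    (h1 : Wr φp (cconj φp) 0 = 1 / (Complex.I * (ap : ℂ)))
    (h2 : Wr φm (cconj φm) 0 = -(1 / (Complex.I * (am : ℂ)))) :
    Wr φm φp 0 ≠ 0 := by
  intro h
  have key := normSq_mul_Wr_cconj h
  have hap' : (ap : ℂ) ≠ 0 := by exact_mod_cast hap.ne'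
  have ham' : (am : ℂ) ≠ 0 := by exact_mod_cast ham.ne'
  have hI := Complex.I_ne_zero
  rw [h1, h2] at key
  field_simp at key
  have hsum : Complex.normSq (φm 0) * am = -(Complex.normSq (φp 0) * ap) := by
    have hsumC : (Complex.normSq (φm 0) : ℂ) * am = -(Complex.normSq (φp 0) * ap) := by
      linear_combination key
    exact_mod_cast hsumC
  have hφp0 : φp 0 = 0 := by
    rw [← Complex.normSq_eq_zero]
    have hp := Complex.normSq_nonneg (φp 0)
    have hm := mul_nonneg (Complex.normSq_nonneg (φm 0)) ham.le
    nlinarith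
  have hW : Wr φp (cconj φp) 0 = 0 := by simp [Wr, cconj, hφp0]
  rw [h1] at hW
  exact one_div_ne_zero (mul_ne_zero hI hap') hW
end

section
/- Let q : ℝ → ℝ be measurable with ∫_a^∞ (1+|t|)·|q(t)| dt < ∞ for every a ∈ ℝ, set Q(x) = ∫_{x/2}^∞ |q(t)| dt, and let D : ℝ⁴ → ℝ be continuous and bounded. Then the integral equation K(x,s) = −2·∫_{(x+s)/2}^∞ q(y)·D(x,y,y,s) dy − 2·∫_x^∞ q(y)·( ∫_{s+x−y}^{s+y−x} D(x,y,t,s)·K(y,t) dt ) dy, for s ≥ x, where K(y,t) is interpreted as 0 whenever t < y, has a continuous solution K on {(x,s) : s ≥ x}, and there exists a positive continuous nonincreasing function C : ℝ → ℝ such that |K(x,s)| ≤ C(x)·Q(x+s) for all s ≥ x. Moreover K is the unique continuous solution that is bounded on {(x,s) : s ≥ x ≥ a} for every a ∈ ℝ. -/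
open MeasureTheory Filter

/-- `Q(x) = ∫_{x/2}^∞ |q(t)| dt`. -/
noncomputable def Qfun (q : ℝ → ℝ) (x : ℝ) : ℝ := ∫ t in Set.Ioi (x / 2), |q t|

section TransformationKernel

open Topology

theorem continuous_setIntegral_Ioi_mul {P : Type*} [TopologicalSpace P] [FirstCountableTopology P]
    {q : ℝ → ℝ} (hq : Measurable q)
    (hmom : ∀ a : ℝ, IntegrableOn (fun t => (1 + |t|) * |q t|) (Set.Ioi a))
    {u : P → ℝ} (hu : Continuous u) {Φ : P → ℝ → ℝ} (hΦ : Continuous (Function.uncurry Φ))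
    (hb : ∀ p₀, ∃ b : ℝ, ∀ᶠ p in 𝓝 p₀, ∀ y, u p < y → |Φ p y| ≤ b * (1 + |y|)) :
    Continuous fun p => ∫ y in Set.Ioi (u p), q y * Φ p y := by
  rw [continuous_iff_continuousAt]
  intro p₀
  obtain ⟨b, hb⟩ := hb p₀
  have hrw : (fun p => ∫ y in Set.Ioi (u p), q y * Φ p y) =
      fun p => ∫ y, (Set.Ioi (u p)).indicator (fun y => q y * Φ p y) y := by
    funext p
    rw [integral_indicator measurableSet_Ioi]
  rw [hrw]
  have hlt : ∀ᶠ p in 𝓝 p₀, u p₀ - 1 < u p :=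
    hu.continuousAt.eventually (lt_mem_nhds (by linarith))
  refine continuousAt_of_dominated
    (bound := (Set.Ioi (u p₀ - 1)).indicator fun y => b * ((1 + |y|) * |q y|)) ?_ ?_ ?_ ?_
  · refine Eventually.of_forall fun p => AEStronglyMeasurable.indicator ?_ measurableSet_Ioi
    exact (hq.mul (hΦ.comp (Continuous.prodMk_right p)).measurable).aestronglyMeasurable
  · filter_upwards [hb, hlt] with p hp hp'
    refine Eventually.of_forall fun y => ?_
    by_cases hy : u p < y
    · rw [Set.indicator_of_mem (show y ∈ Set.Ioi (u p) from hy),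
        Set.indicator_of_mem (show y ∈ Set.Ioi (u p₀ - 1) from hp'.trans hy), Real.norm_eq_abs,
        abs_mul]
      calc |q y| * |Φ p y| ≤ |q y| * (b * (1 + |y|)) :=
            mul_le_mul_of_nonneg_left (hp y hy) (abs_nonneg _)
        _ = _ := by ring
    · rw [Set.indicator_of_notMem (show y ∉ Set.Ioi (u p) from hy), norm_zero]
      by_cases hy' : u p₀ - 1 < y
      · rw [Set.indicator_of_mem (show y ∈ Set.Ioi (u p₀ - 1) from hy')]
        have hb0 : 0 ≤ b := by
          have h := (abs_nonneg _).trans (hp (u p + 1) (by linarith))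
          exact nonneg_of_mul_nonneg_left h (by positivity)
        positivity
      · rw [Set.indicator_of_notMem (show y ∉ Set.Ioi (u p₀ - 1) from hy')]
  · exact (integrable_indicator_iff measurableSet_Ioi).2 ((hmom _).const_mul b)
  · have hne : ∀ᵐ y : ℝ, y ≠ u p₀ := by
      simp [ae_iff, measure_singleton]
    filter_upwards [hne] with y hy
    have hc : ContinuousAt (fun p => q y * Φ p y) p₀ :=
      (continuous_const.mul (hΦ.comp (Continuous.prodMk_left y))).continuousAt
    rcases lt_or_gt_of_ne hy with h | h
    · have : (fun p => (Set.Ioi (u p)).indicator (fun y => q y * Φ p y) y) =ᶠ[𝓝 p₀]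
          fun _ => 0 := by
        filter_upwards [hu.continuousAt.eventually (lt_mem_nhds h)] with p hp
        exact Set.indicator_of_notMem (by simpa using hp.le) _
      exact continuousAt_const.congr this.symm
    · have : (fun p => (Set.Ioi (u p)).indicator (fun y => q y * Φ p y) y) =ᶠ[𝓝 p₀]
          fun p => q y * Φ p y := by
        filter_upwards [hu.continuousAt.eventually (gt_mem_nhds h)] with p hp
        exact Set.indicator_of_mem (by simpa using hp) _
      exact hc.congr this.symm

theorem lintegral_Ioi_mul_lintegral_Ioo {g W : ℝ → ENNReal} (hg : Measurable g)
    (hW : Measurable W) (x : ℝ) :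
    ∫⁻ y in Set.Ioi x, g y * ∫⁻ z in Set.Ioo x y, W z =
      ∫⁻ z in Set.Ioi x, W z * ∫⁻ y in Set.Ioi z, g y := by
  have h1 : ∀ y, g y * ∫⁻ z in Set.Ioo x y, W z =
      ∫⁻ z in Set.Ioi x, {p : ℝ × ℝ | p.2 < p.1}.indicator (fun p => g p.1 * W p.2) (y, z) := by
    intro y
    rw [← lintegral_const_mul _ hW, ← Set.Ioi_inter_Iio, Set.inter_comm,
      ← Measure.restrict_restrict measurableSet_Iio, ← lintegral_indicator measurableSet_Iio]
    rfl
  have h2 : ∀ z ∈ Set.Ioi x, W z * ∫⁻ y in Set.Ioi z, g y =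
      ∫⁻ y in Set.Ioi x, {p : ℝ × ℝ | p.2 < p.1}.indicator (fun p => g p.1 * W p.2) (y, z) := by
    intro z hz
    rw [← lintegral_const_mul _ hg,
      ← Set.inter_eq_self_of_subset_left (Set.Ioi_subset_Ioi (le_of_lt hz)),
      ← Measure.restrict_restrict measurableSet_Ioi, ← lintegral_indicator measurableSet_Ioi]
    refine lintegral_congr fun y => ?_
    by_cases h : z < y
    · simp [Set.indicator, h, mul_comm]
    · simp [Set.indicator, h]
  rw [setLIntegral_congr_fun measurableSet_Ioi h2]
  simp_rw [h1]
  refine lintegral_lintegral_swap (Measurable.aemeasurable ?_)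
  exact ((hg.comp measurable_fst).mul (hW.comp measurable_snd)).indicator
    (measurableSet_lt measurable_snd measurable_fst)

theorem integrableOn_Ioi_mul_of_le {g h : ℝ → ℝ} (hg : Measurable g) (hh : Measurable h) {a b : ℝ}
    (hmom : IntegrableOn (fun t => (1 + |t|) * |g t|) (Set.Ioi a))
    (hb : ∀ y, a < y → |h y| ≤ b * (1 + |y|)) :
    IntegrableOn (fun y => g y * h y) (Set.Ioi a) := by
  refine Integrable.mono' (hmom.const_mul b) (hg.mul hh).aestronglyMeasurable ?_
  filter_upwards [ae_restrict_mem measurableSet_Ioi] with y hy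
  rw [Real.norm_eq_abs, abs_mul]
  calc |g y| * |h y| ≤ |g y| * (b * (1 + |y|)) :=
        mul_le_mul_of_nonneg_left (hb y hy) (abs_nonneg _)
    _ = _ := by ring

theorem integrableOn_Ioi_of_moment {g : ℝ → ℝ} (hg : Measurable g) {a : ℝ}
    (hmom : IntegrableOn (fun t => (1 + |t|) * |g t|) (Set.Ioi a)) :
    IntegrableOn g (Set.Ioi a) := by
  have h := integrableOn_Ioi_mul_of_le hg (measurable_const (a := (1 : ℝ))) (b := 1) hmom
    (fun y _ => by simp)
  simpa using h

theorem sub_le_mul_one_add_abs (x y : ℝ) : y - x ≤ (|x| + 1) * (1 + |y|) := by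
  have h1 := le_abs_self y
  have h2 := neg_abs_le x
  nlinarith [abs_nonneg x, abs_nonneg y, mul_nonneg (abs_nonneg x) (abs_nonneg y)]

theorem lintegral_Ioi_ofReal_tail {g : ℝ → ℝ} (hg : Measurable g) (hg0 : ∀ y, 0 ≤ g y)
    (hmom : ∀ a : ℝ, IntegrableOn (fun t => (1 + |t|) * |g t|) (Set.Ioi a))
    {V : ℝ → ℝ} (hV : Measurable V) (hV0 : ∀ y, 0 ≤ V y) (x : ℝ) :
    ∫⁻ z in Set.Ioi x, ENNReal.ofReal (V z * ∫ y in Set.Ioi z, g y) =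
      ∫⁻ y in Set.Ioi x, ENNReal.ofReal (g y) * ∫⁻ z in Set.Ioo x y, ENNReal.ofReal (V z) := by
  rw [lintegral_Ioi_mul_lintegral_Ioo hg.ennreal_ofReal hV.ennreal_ofReal]
  refine lintegral_congr fun z => ?_
  rw [ENNReal.ofReal_mul (hV0 z), ofReal_integral_eq_lintegral_ofReal
    (integrableOn_Ioi_of_moment hg (hmom z)) (Eventually.of_forall hg0)]

theorem integrableOn_Ioi_tail {g : ℝ → ℝ} (hg : Measurable g) (hg0 : ∀ y, 0 ≤ g y)
    (hmom : ∀ a : ℝ, IntegrableOn (fun t => (1 + |t|) * |g t|) (Set.Ioi a))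
    (hρ : Continuous fun z => ∫ y in Set.Ioi z, g y) (x : ℝ) :
    IntegrableOn (fun z => ∫ y in Set.Ioi z, g y) (Set.Ioi x) := by
  refine ⟨hρ.aestronglyMeasurable, ?_⟩
  rw [hasFiniteIntegral_iff_ofReal (Eventually.of_forall fun z => integral_nonneg hg0)]
  have h := lintegral_Ioi_ofReal_tail hg hg0 hmom (measurable_const (a := (1 : ℝ)))
    (fun _ => zero_le_one) x
  simp only [one_mul] at h
  rw [h]
  have hint : IntegrableOn (fun y => g y * (y - x)) (Set.Ioi x) :=
    integrableOn_Ioi_mul_of_le hg (by fun_prop) (hmom x) (b := |x| + 1) fun y hy => by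
      rw [abs_of_pos (sub_pos.2 hy)]
      exact sub_le_mul_one_add_abs x y
  refine lt_of_eq_of_lt (setLIntegral_congr_fun measurableSet_Ioi fun y hy => ?_)
    hint.lintegral_lt_top
  simp [ENNReal.ofReal_mul (hg0 y)]

theorem integral_Ioi_mul_sub_mul_le {g : ℝ → ℝ} (hg : Measurable g) (hg0 : ∀ y, 0 ≤ g y)
    (hmom : ∀ a : ℝ, IntegrableOn (fun t => (1 + |t|) * |g t|) (Set.Ioi a))
    {V : ℝ → ℝ} (hV : Measurable V) (hV0 : ∀ y, 0 ≤ V y) (hanti : Antitone V) (x : ℝ)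
    (hint : IntegrableOn (fun z => V z * ∫ y in Set.Ioi z, g y) (Set.Ioi x)) :
    ∫ y in Set.Ioi x, g y * ((y - x) * V y) ≤
      ∫ z in Set.Ioi x, V z * ∫ y in Set.Ioi z, g y := by
  have hnn : ∀ y ∈ Set.Ioi x, 0 ≤ g y * ((y - x) * V y) := fun y hy =>
    mul_nonneg (hg0 y) (mul_nonneg (sub_nonneg.2 (le_of_lt hy)) (hV0 y))
  rw [integral_eq_lintegral_of_nonneg_ae
      ((ae_restrict_mem measurableSet_Ioi).mono hnn)
      (hg.mul ((measurable_id.sub_const x).mul hV)).aestronglyMeasurable,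
    integral_eq_lintegral_of_nonneg_ae
      (Eventually.of_forall fun z => mul_nonneg (hV0 z) (integral_nonneg hg0))
      hint.aestronglyMeasurable]
  refine ENNReal.toReal_mono hint.lintegral_lt_top.ne ?_
  rw [lintegral_Ioi_ofReal_tail hg hg0 hmom hV hV0]
  refine setLIntegral_mono' measurableSet_Ioi fun y hy => ?_
  rw [ENNReal.ofReal_mul (hg0 y)]
  gcongr
  calc ENNReal.ofReal ((y - x) * V y) = ∫⁻ _ in Set.Ioo x y, ENNReal.ofReal (V y) := by
        rw [setLIntegral_const, Real.volume_Ioo, mul_comm, ENNReal.ofReal_mul (hV0 y)]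
    _ ≤ _ := setLIntegral_mono' measurableSet_Ioo fun z hz =>
        ENNReal.ofReal_le_ofReal (hanti hz.2.le)

/-- The weight is `exp (2 ∫ₓ^∞ ρ) (1 + ρ x)`, where `ρ x = ∫ₓ^∞ g`. -/
theorem exists_weight {g : ℝ → ℝ} (hg : Measurable g) (hg0 : ∀ y, 0 ≤ g y)
    (hmom : ∀ a : ℝ, IntegrableOn (fun t => (1 + |t|) * |g t|) (Set.Ioi a)) :
    ∃ w : ℝ → ℝ, Continuous w ∧ Antitone w ∧ (∀ x, 1 ≤ w x) ∧
      (∀ x, ∫ y in Set.Ioi x, g y ≤ w x) ∧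
      ∀ x, ∫ y in Set.Ioi x, g y * ((y - x) * w y) ≤ w x / 2 := by
  obtain ⟨ρ, hρ⟩ : ∃ ρ : ℝ → ℝ, ρ = fun z => ∫ y in Set.Ioi z, g y := ⟨_, rfl⟩
  have hρz : ∀ z, ρ z = ∫ y in Set.Ioi z, g y := fun z => congrFun hρ z
  have hρc : Continuous ρ := by
    have h := continuous_setIntegral_Ioi_mul hg hmom continuous_id
      (Φ := fun _ _ : ℝ => (1 : ℝ)) continuous_const
      fun p₀ => ⟨1, Eventually.of_forall fun p y _ => by simp⟩
    simpa [hρ] using h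
  have hρ0 : ∀ z, 0 ≤ ρ z := fun z => by rw [hρz]; exact integral_nonneg hg0
  have hρanti : Antitone ρ := fun a b hab => by
    rw [hρz, hρz]
    exact setIntegral_mono_set (integrableOn_Ioi_of_moment hg (hmom a))
      (Eventually.of_forall hg0) (Set.Ioi_subset_Ioi hab).eventuallyLE
  have hρint : ∀ x, IntegrableOn ρ (Set.Ioi x) := fun x => by
    have := integrableOn_Ioi_tail hg hg0 hmom (by rw [← hρ]; exact hρc) x
    rwa [← hρ] at this
  obtain ⟨σ, hσ⟩ : ∃ σ : ℝ → ℝ, σ = fun x => (∫ z in Set.Ioi 0, ρ z) - ∫ z in (0 : ℝ)..x, ρ z :=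
    ⟨_, rfl⟩
  have hσd : ∀ x, HasDerivAt σ (-ρ x) x := fun x => by
    rw [hσ]
    exact (intervalIntegral.integral_hasDerivAt_right (hρc.intervalIntegrable _ _)
      (hρc.stronglyMeasurableAtFilter _ _) hρc.continuousAt).const_sub _
  have hσlim : Tendsto σ atTop (𝓝 0) := by
    rw [hσ]
    simpa using (intervalIntegral_tendsto_integral_Ioi 0 (hρint 0) tendsto_id).const_sub
      (∫ z in Set.Ioi 0, ρ z)
  have hσanti : Antitone σ := antitone_of_hasDerivAt_nonpos hσd fun x => by simpa using hρ0 x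
  have hσ0 : ∀ x, 0 ≤ σ x := fun x => hσanti.le_of_tendsto hσlim x
  have hσc : Continuous σ := continuous_iff_continuousAt.2 fun x => (hσd x).continuousAt
  obtain ⟨v, hv⟩ : ∃ v : ℝ → ℝ, v = fun x => Real.exp (2 * σ x) := ⟨_, rfl⟩
  have hvc : Continuous v := by rw [hv]; fun_prop
  have hv1 : ∀ x, 1 ≤ v x := fun x => by
    rw [hv]; exact Real.one_le_exp (by linarith [hσ0 x])
  have hv0 : ∀ x, 0 ≤ v x := fun x => zero_le_one.trans (hv1 x)
  have hvanti : Antitone v := fun a b hab => by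
    rw [hv]; exact Real.exp_le_exp.2 (by linarith [hσanti hab])
  have hvd : ∀ x, HasDerivAt v (-2 * (v x * ρ x)) x := fun x => by
    rw [hv]
    convert ((hσd x).const_mul 2).exp using 1
    ring
  have hvlim : Tendsto v atTop (𝓝 1) := by
    rw [hv]
    simpa [Function.comp_def] using (Real.continuous_exp.tendsto _).comp (hσlim.const_mul 2)
  have hvint : ∀ x, IntegrableOn (fun z => -2 * (v z * ρ z)) (Set.Ioi x) := fun x =>
    integrableOn_Ioi_deriv_of_nonpos' (fun y _ => hvd y)
      (fun y _ => by nlinarith [mul_nonneg (hv0 y) (hρ0 y)]) hvlim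
  have hvρint : ∀ x, IntegrableOn (fun z => v z * ρ z) (Set.Ioi x) := fun x => by
    have := (hvint x).const_mul (-1 / 2 : ℝ)
    refine this.congr (Eventually.of_forall fun z => ?_)
    ring
  have hvρ : ∀ x, ∫ z in Set.Ioi x, v z * ρ z ≤ v x / 2 := fun x => by
    have h := integral_Ioi_of_hasDerivAt_of_tendsto' (fun y _ => hvd y) (hvint x) hvlim
    rw [integral_const_mul] at h
    linarith
  have hmain : ∀ x, ∫ y in Set.Ioi x, g y * ((y - x) * v y) ≤ v x / 2 := fun x => by
    have h := integral_Ioi_mul_sub_mul_le hg hg0 hmom hvc.measurable hv0 hvanti x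
      (by simpa only [← hρz] using hvρint x)
    simp only [← hρz] at h
    exact h.trans (hvρ x)
  have hint : ∀ x, IntegrableOn (fun y => g y * ((y - x) * v y)) (Set.Ioi x) := fun x =>
    integrableOn_Ioi_mul_of_le hg (by fun_prop) (hmom x) (b := v x * (|x| + 1)) fun y hy => by
      have hyx : 0 < y - x := sub_pos.2 hy
      rw [abs_of_nonneg (mul_nonneg hyx.le (hv0 y))]
      nlinarith [mul_le_mul (sub_le_mul_one_add_abs x y) (hvanti (le_of_lt hy)) (hv0 y)
        (by positivity)]
  refine ⟨fun x => v x * (1 + ρ x), by fun_prop, fun a b hab => ?_, fun x => ?_, fun x => ?_,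
    fun x => ?_⟩
  · exact mul_le_mul (hvanti hab) (by linarith [hρanti hab]) (by linarith [hρ0 b]) (hv0 a)
  · nlinarith [hv1 x, hρ0 x]
  · rw [← hρz]
    nlinarith [hv1 x, hρ0 x]
  · calc ∫ y in Set.Ioi x, g y * ((y - x) * (v y * (1 + ρ y)))
        ≤ ∫ y in Set.Ioi x, (1 + ρ x) * (g y * ((y - x) * v y)) := by
          refine integral_mono_of_nonneg ?_ ((hint x).const_mul _) ?_
          · filter_upwards [ae_restrict_mem measurableSet_Ioi] with y hy
            have hyx : 0 < y - x := sub_pos.2 hy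
            exact mul_nonneg (hg0 y) (mul_nonneg hyx.le
              (mul_nonneg (hv0 y) (by linarith [hρ0 y])))
          · filter_upwards [ae_restrict_mem measurableSet_Ioi] with y hy
            have hyx : 0 < y - x := sub_pos.2 hy
            have h1 : 0 ≤ g y * ((y - x) * v y) :=
              mul_nonneg (hg0 y) (mul_nonneg hyx.le (hv0 y))
            nlinarith [mul_le_mul_of_nonneg_left (hρanti (le_of_lt hy)) h1]
      _ = (1 + ρ x) * ∫ y in Set.Ioi x, g y * ((y - x) * v y) := integral_const_mul _ _
      _ ≤ (1 + ρ x) * (v x / 2) :=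
          mul_le_mul_of_nonneg_left (hmain x) (by linarith [hρ0 x])
      _ = _ := by ring

/-- The inner integral of the equation, with its range cut down to `t ≥ y`. -/
noncomputable def innerInt (D : ℝ → ℝ → ℝ → ℝ → ℝ) (K : ℝ → ℝ → ℝ) (x s y : ℝ) : ℝ :=
  ∫ t in (max y (s + x - y))..(s + y - x), D x y t s * K y t

theorem continuous_innerInt {D : ℝ → ℝ → ℝ → ℝ → ℝ}
    (hD : Continuous fun p : ℝ × ℝ × ℝ × ℝ => D p.1 p.2.1 p.2.2.1 p.2.2.2)
    {K : ℝ → ℝ → ℝ} (hK : Continuous fun p : ℝ × ℝ => K p.1 p.2) :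
    Continuous fun p : ℝ × ℝ × ℝ => innerInt D K p.1 p.2.1 p.2.2 := by
  have hf : Continuous (Function.uncurry fun (p : ℝ × ℝ × ℝ) (t : ℝ) =>
      D p.1 p.2.2 t p.2.1 * K p.2.2 t) := by
    refine Continuous.mul ?_ ?_
    · exact hD.comp (f := fun r : (ℝ × ℝ × ℝ) × ℝ => (r.1.1, r.1.2.2, r.2, r.1.2.1))
        (by fun_prop)
    · exact hK.comp (f := fun r : (ℝ × ℝ × ℝ) × ℝ => (r.1.2.2, r.2)) (by fun_prop)
  have hi : ∀ (p : ℝ × ℝ × ℝ) (a b : ℝ), IntervalIntegrable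
      (fun t => D p.1 p.2.2 t p.2.1 * K p.2.2 t) volume a b := fun p a b =>
    (hf.comp (Continuous.prodMk_right p)).intervalIntegrable a b
  have hrw : (fun p : ℝ × ℝ × ℝ => innerInt D K p.1 p.2.1 p.2.2) = fun p =>
      (∫ t in (0 : ℝ)..(p.2.1 + p.2.2 - p.1), D p.1 p.2.2 t p.2.1 * K p.2.2 t) -
        ∫ t in (0 : ℝ)..(max p.2.2 (p.2.1 + p.1 - p.2.2)), D p.1 p.2.2 t p.2.1 * K p.2.2 t := by
    funext p
    rw [intervalIntegral.integral_interval_sub_left (hi p _ _) (hi p _ _), innerInt]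
  rw [hrw]
  exact (intervalIntegral.continuous_parametric_intervalIntegral_of_continuous hf
    (by fun_prop)).sub (intervalIntegral.continuous_parametric_intervalIntegral_of_continuous hf
    (by fun_prop))

theorem abs_innerInt_le {D : ℝ → ℝ → ℝ → ℝ → ℝ} {M : ℝ} (hDbd : ∀ x y t s, |D x y t s| ≤ M)
    {K : ℝ → ℝ → ℝ} {x s y b : ℝ} (hxs : x ≤ s) (hxy : x ≤ y)
    (hb : ∀ t, y ≤ t → x + s ≤ y + t → |K y t| ≤ b) :
    |innerInt D K x s y| ≤ M * b * (2 * (y - x)) := by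
  have hM : 0 ≤ M := (abs_nonneg _).trans (hDbd 0 0 0 0)
  have hle : max y (s + x - y) ≤ s + y - x := max_le (by linarith) (by linarith)
  have hb0 : 0 ≤ b := (abs_nonneg _).trans (hb (s + y - x) (by linarith) (by linarith))
  have h := intervalIntegral.norm_integral_le_of_norm_le_const (a := max y (s + x - y))
    (b := s + y - x) (C := M * b) (f := fun t => D x y t s * K y t) fun t ht => by
      rw [Set.uIoc_of_le hle] at ht
      have h1 : y < t := (le_max_left _ _).trans_lt ht.1
      have h2 : s + x - y < t := (le_max_right _ _).trans_lt ht.1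
      rw [Real.norm_eq_abs, abs_mul]
      exact mul_le_mul (hDbd _ _ _ _) (hb t h1.le (by linarith)) (abs_nonneg _) hM
  rw [Real.norm_eq_abs, abs_of_nonneg (sub_nonneg.2 hle)] at h
  refine h.trans (mul_le_mul_of_nonneg_left ?_ (mul_nonneg hM hb0))
  linarith [le_max_right y (s + x - y)]

theorem integral_ite_eq_innerInt (D : ℝ → ℝ → ℝ → ℝ → ℝ) {K K' : ℝ → ℝ → ℝ} {x s y : ℝ}
    (hxs : x ≤ s) (hxy : x ≤ y) (hK : ∀ t, y ≤ t → K y t = K' y t) :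
    ∫ t in (s + x - y)..(s + y - x), D x y t s * (if y ≤ t then K y t else 0) =
      innerInt D K' x s y := by
  rw [innerInt, intervalIntegral.integral_of_le (by linarith),
    intervalIntegral.integral_of_le (max_le (by linarith) (by linarith)),
    max_comm, ← Set.Ioc_inter_Ioi, setIntegral_congr_set
      (Filter.EventuallyEq.rfl.inter Ioi_ae_eq_Ici),
    ← setIntegral_indicator measurableSet_Ici]
  congr 1
  funext t
  by_cases h : y ≤ t
  · simp [Set.indicator, h, hK t h]
  · simp [Set.indicator, h]

theorem integrableOn_mul_innerInt {q : ℝ → ℝ} (hq : Measurable q)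
    (hmom : ∀ a : ℝ, IntegrableOn (fun t => (1 + |t|) * |q t|) (Set.Ioi a))
    {D : ℝ → ℝ → ℝ → ℝ → ℝ}
    (hD : Continuous fun p : ℝ × ℝ × ℝ × ℝ => D p.1 p.2.1 p.2.2.1 p.2.2.2)
    {M : ℝ} (hDbd : ∀ x y t s, |D x y t s| ≤ M)
    {K : ℝ → ℝ → ℝ} (hK : Continuous fun p : ℝ × ℝ => K p.1 p.2) {x s b : ℝ} (hxs : x ≤ s)
    (hb : ∀ y t, x ≤ y → y ≤ t → |K y t| ≤ b) :
    IntegrableOn (fun y => q y * innerInt D K x s y) (Set.Ioi x) := by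
  have hM : 0 ≤ M := (abs_nonneg _).trans (hDbd 0 0 0 0)
  have hb0 : 0 ≤ b := (abs_nonneg _).trans (hb x x le_rfl le_rfl)
  refine integrableOn_Ioi_mul_of_le hq ?_ (hmom x) (b := 2 * (M * b) * (|x| + 1)) fun y hy => ?_
  · exact ((continuous_innerInt hD hK).comp (f := fun y : ℝ => (x, s, y))
      (by fun_prop)).measurable
  · have h := abs_innerInt_le hDbd (K := K) hxs hy.le fun t ht _ => hb y t hy.le ht
    nlinarith [mul_le_mul_of_nonneg_left (sub_le_mul_one_add_abs x y) (mul_nonneg hM hb0)]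

theorem integral_mul_innerInt_sub {q : ℝ → ℝ} (hq : Measurable q)
    (hmom : ∀ a : ℝ, IntegrableOn (fun t => (1 + |t|) * |q t|) (Set.Ioi a))
    {D : ℝ → ℝ → ℝ → ℝ → ℝ}
    (hD : Continuous fun p : ℝ × ℝ × ℝ × ℝ => D p.1 p.2.1 p.2.2.1 p.2.2.2)
    {M : ℝ} (hDbd : ∀ x y t s, |D x y t s| ≤ M)
    {K L : ℝ → ℝ → ℝ} (hK : Continuous fun p : ℝ × ℝ => K p.1 p.2)
    (hL : Continuous fun p : ℝ × ℝ => L p.1 p.2) {x s b b' : ℝ} (hxs : x ≤ s)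
    (hb : ∀ y t, x ≤ y → y ≤ t → |K y t| ≤ b) (hb' : ∀ y t, x ≤ y → y ≤ t → |L y t| ≤ b') :
    ∫ y in Set.Ioi x, q y * innerInt D (fun y t => K y t - L y t) x s y =
      (∫ y in Set.Ioi x, q y * innerInt D K x s y) -
        ∫ y in Set.Ioi x, q y * innerInt D L x s y := by
  rw [← integral_sub (integrableOn_mul_innerInt hq hmom hD hDbd hK hxs hb)
    (integrableOn_mul_innerInt hq hmom hD hDbd hL hxs hb')]
  congr 1
  funext y
  have hDc : Continuous fun t => D x y t s :=
    hD.comp (f := fun t : ℝ => (x, y, t, s)) (by fun_prop)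
  have hi : ∀ {N : ℝ → ℝ → ℝ}, (Continuous fun p : ℝ × ℝ => N p.1 p.2) → ∀ a c : ℝ,
      IntervalIntegrable (fun t => D x y t s * N y t) volume a c := fun hN a c =>
    (hDc.mul (hN.comp (Continuous.prodMk_right y))).intervalIntegrable a c
  rw [← mul_sub, innerInt, innerInt, innerInt,
    ← intervalIntegral.integral_sub (hi hK _ _) (hi hL _ _)]
  simp_rw [mul_sub]

theorem abs_integral_mul_innerInt_le {q : ℝ → ℝ} (hq : Measurable q)
    (hmom : ∀ a : ℝ, IntegrableOn (fun t => (1 + |t|) * |q t|) (Set.Ioi a))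
    {D : ℝ → ℝ → ℝ → ℝ → ℝ} {M : ℝ} (hDbd : ∀ x y t s, |D x y t s| ≤ M)
    {w : ℝ → ℝ} (hwc : Continuous w) (hwa : Antitone w) (hw1 : ∀ x, 1 ≤ w x)
    (hwi : ∀ x, ∫ y in Set.Ioi x, 4 * M * |q y| * ((y - x) * w y) ≤ w x / 2)
    {K : ℝ → ℝ → ℝ} {x s c : ℝ} (hxs : x ≤ s)
    (hc : ∀ y t, x ≤ y → y ≤ t → x + s ≤ y + t → |K y t| ≤ c * w y) :
    |2 * ∫ y in Set.Ioi x, q y * innerInt D K x s y| ≤ c * w x / 2 := by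
  have hc0 : 0 ≤ c :=
    nonneg_of_mul_nonneg_left ((abs_nonneg _).trans (hc x s le_rfl hxs le_rfl))
      (zero_lt_one.trans_le (hw1 x))
  have hint : IntegrableOn (fun y => |q y| * ((y - x) * w y)) (Set.Ioi x) :=
    integrableOn_Ioi_mul_of_le hq.abs (by fun_prop) (by simpa using hmom x)
      (b := w x * (|x| + 1)) fun y hy => by
      have hyx : 0 < y - x := sub_pos.2 hy
      have hwy : 0 ≤ w y := zero_le_one.trans (hw1 y)
      rw [abs_of_nonneg (mul_nonneg hyx.le hwy)]
      nlinarith [mul_le_mul (sub_le_mul_one_add_abs x y) (hwa (le_of_lt hy)) hwy (by positivity)]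
  have h1 : |∫ y in Set.Ioi x, q y * innerInt D K x s y| ≤
      ∫ y in Set.Ioi x, 2 * M * c * (|q y| * ((y - x) * w y)) := by
    rw [← Real.norm_eq_abs]
    refine norm_integral_le_of_norm_le (hint.const_mul _) ?_
    filter_upwards [ae_restrict_mem measurableSet_Ioi] with y hy
    have hxy : x ≤ y := le_of_lt hy
    rw [Real.norm_eq_abs, abs_mul]
    calc |q y| * |innerInt D K x s y| ≤ |q y| * (M * (c * w y) * (2 * (y - x))) :=
          mul_le_mul_of_nonneg_left
            (abs_innerInt_le hDbd hxs hxy fun t ht ht' => hc y t hxy ht ht') (abs_nonneg _)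
      _ = _ := by ring
  have h2 := hwi x
  simp only [mul_assoc] at h2
  rw [integral_const_mul, integral_const_mul] at h2
  rw [integral_const_mul] at h1
  rw [abs_mul, abs_two]
  nlinarith [mul_le_mul_of_nonneg_left h2 hc0]

theorem Qfun_nonneg (q : ℝ → ℝ) (x : ℝ) : 0 ≤ Qfun q x :=
  integral_nonneg fun _ => abs_nonneg _

theorem antitone_Qfun {q : ℝ → ℝ} (hq : Measurable q)
    (hmom : ∀ a : ℝ, IntegrableOn (fun t => (1 + |t|) * |q t|) (Set.Ioi a)) :
    Antitone (Qfun q) := fun a _ hab =>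
  setIntegral_mono_set (integrableOn_Ioi_of_moment hq.abs (by simpa using hmom (a / 2)))
    (Eventually.of_forall fun _ => abs_nonneg _)
    (Set.Ioi_subset_Ioi (by linarith)).eventuallyLE

theorem abs_le_of_abs_le_add_integral {q : ℝ → ℝ} (hq : Measurable q)
    (hmom : ∀ a : ℝ, IntegrableOn (fun t => (1 + |t|) * |q t|) (Set.Ioi a))
    {D : ℝ → ℝ → ℝ → ℝ → ℝ} {M : ℝ} (hDbd : ∀ x y t s, |D x y t s| ≤ M)
    {w : ℝ → ℝ} (hwc : Continuous w) (hwa : Antitone w) (hw1 : ∀ x, 1 ≤ w x)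
    (hwi : ∀ x, ∫ y in Set.Ioi x, 4 * M * |q y| * ((y - x) * w y) ≤ w x / 2)
    {K : ℝ → ℝ → ℝ} {a b c : ℝ} (hc : 0 ≤ c)
    (hb : ∀ x s, a ≤ x → x ≤ s → |K x s| ≤ b * w x)
    (hK : ∀ x s, a ≤ x → x ≤ s → |K x s| ≤
      c * Qfun q (x + s) + |2 * ∫ y in Set.Ioi x, q y * innerInt D K x s y|)
    {x s : ℝ} (hax : a ≤ x) (hxs : x ≤ s) :
    |K x s| ≤ 2 * c * w x * Qfun q (x + s) := by
  have key : ∀ n : ℕ, ∀ x s, a ≤ x → x ≤ s →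
      |K x s| ≤ (2 * c * Qfun q (x + s) + b * (1 / 2) ^ n) * w x := by
    intro n
    induction n with
    | zero =>
      intro x s hax hxs
      have h1 := mul_nonneg (mul_nonneg hc (Qfun_nonneg q (x + s)))
        (zero_le_one.trans (hw1 x))
      have := hb x s hax hxs
      rw [pow_zero]
      linarith
    | succ n ih =>
      intro x s hax hxs
      have h1 := abs_integral_mul_innerInt_le hq hmom hDbd hwc hwa hw1 hwi (K := K) hxs
        (c := 2 * c * Qfun q (x + s) + b * (1 / 2) ^ n) fun y t hxy hyt hle => by
          refine (ih y t (hax.trans hxy) hyt).trans ?_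
          refine mul_le_mul_of_nonneg_right ?_ (zero_le_one.trans (hw1 y))
          linarith [mul_le_mul_of_nonneg_left (antitone_Qfun hq hmom hle) hc]
      have h2 := hK x s hax hxs
      have h3 := mul_nonneg hc (Qfun_nonneg q (x + s))
      rw [pow_succ]
      nlinarith [mul_le_mul_of_nonneg_left (hw1 x) h3]
  have hlim : Tendsto (fun n : ℕ => (2 * c * Qfun q (x + s) + b * (1 / 2) ^ n) * w x) atTop
      (𝓝 ((2 * c * Qfun q (x + s) + b * 0) * w x)) :=
    (((tendsto_pow_atTop_nhds_zero_of_lt_one (by norm_num) (by norm_num)).const_mul b).const_add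
      _).mul_const _
  have := ge_of_tendsto' hlim fun n => key n x s hax hxs
  linarith

theorem continuous_source {q : ℝ → ℝ} (hq : Measurable q)
    (hmom : ∀ a : ℝ, IntegrableOn (fun t => (1 + |t|) * |q t|) (Set.Ioi a))
    {D : ℝ → ℝ → ℝ → ℝ → ℝ}
    (hD : Continuous fun p : ℝ × ℝ × ℝ × ℝ => D p.1 p.2.1 p.2.2.1 p.2.2.2)
    {M : ℝ} (hDbd : ∀ x y t s, |D x y t s| ≤ M) :
    Continuous fun p : ℝ × ℝ => ∫ y in Set.Ioi ((p.1 + p.2) / 2), q y * D p.1 y y p.2 := by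
  have hM : 0 ≤ M := (abs_nonneg _).trans (hDbd 0 0 0 0)
  refine continuous_setIntegral_Ioi_mul hq hmom (u := fun p : ℝ × ℝ => (p.1 + p.2) / 2)
    (Φ := fun p y => D p.1 y y p.2) (by fun_prop) ?_ fun p₀ =>
      ⟨M, Eventually.of_forall fun p y _ => (hDbd _ _ _ _).trans ?_⟩
  · exact hD.comp (f := fun r : (ℝ × ℝ) × ℝ => (r.1.1, r.2, r.2, r.1.2)) (by fun_prop)
  · nlinarith [abs_nonneg y]

theorem abs_source_le {q : ℝ → ℝ} (hq : Measurable q)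
    (hmom : ∀ a : ℝ, IntegrableOn (fun t => (1 + |t|) * |q t|) (Set.Ioi a))
    {D : ℝ → ℝ → ℝ → ℝ → ℝ} {M : ℝ} (hDbd : ∀ x y t s, |D x y t s| ≤ M) (x s : ℝ) :
    |∫ y in Set.Ioi ((x + s) / 2), q y * D x y y s| ≤ M * Qfun q (x + s) := by
  rw [Qfun, ← integral_const_mul, ← Real.norm_eq_abs]
  refine norm_integral_le_of_norm_le
    ((integrableOn_Ioi_of_moment hq.abs (by simpa using hmom _)).const_mul M)
    (Eventually.of_forall fun y => ?_)
  rw [Real.norm_eq_abs, abs_mul, mul_comm]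
  exact mul_le_mul_of_nonneg_right (hDbd _ _ _ _) (abs_nonneg _)

theorem continuous_integral_mul_innerInt {q : ℝ → ℝ} (hq : Measurable q)
    (hmom : ∀ a : ℝ, IntegrableOn (fun t => (1 + |t|) * |q t|) (Set.Ioi a))
    {D : ℝ → ℝ → ℝ → ℝ → ℝ}
    (hD : Continuous fun p : ℝ × ℝ × ℝ × ℝ => D p.1 p.2.1 p.2.2.1 p.2.2.2)
    {M : ℝ} (hDbd : ∀ x y t s, |D x y t s| ≤ M)
    {K : ℝ → ℝ → ℝ} (hK : Continuous fun p : ℝ × ℝ => K p.1 p.2) {w : ℝ → ℝ}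
    (hwa : Antitone w) (hb : ∀ y t, |K y t| ≤ w y) :
    Continuous fun p : ℝ × ℝ =>
      ∫ y in Set.Ioi p.1, q y * innerInt D K p.1 (max p.1 p.2) y := by
  have hM : 0 ≤ M := (abs_nonneg _).trans (hDbd 0 0 0 0)
  have hw0 : ∀ x, 0 ≤ w x := fun x => (abs_nonneg _).trans (hb x 0)
  refine continuous_setIntegral_Ioi_mul hq hmom (u := fun p : ℝ × ℝ => p.1)
    (Φ := fun p y => innerInt D K p.1 (max p.1 p.2) y) continuous_fst ?_ fun p₀ =>
      ⟨2 * (M * w (p₀.1 - 1)) * (|p₀.1 - 1| + 1), ?_⟩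
  · exact (continuous_innerInt hD hK).comp
      (f := fun r : (ℝ × ℝ) × ℝ => (r.1.1, max r.1.1 r.1.2, r.2)) (by fun_prop)
  · filter_upwards [continuous_fst.continuousAt.eventually
      (lt_mem_nhds (show p₀.1 - 1 < p₀.1 by linarith))] with p hp y hy
    refine (abs_innerInt_le hDbd (le_max_left _ _) hy.le fun t _ _ =>
      (hb y t).trans (hwa (hp.trans hy).le)).trans ?_
    nlinarith [mul_le_mul_of_nonneg_left (sub_le_mul_one_add_abs (p₀.1 - 1) y)
      (mul_nonneg hM (hw0 (p₀.1 - 1))),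
      mul_le_mul_of_nonneg_left (sub_le_sub_left (le_of_lt hp) y)
      (mul_nonneg hM (hw0 (p₀.1 - 1)))]

open scoped BoundedContinuousFunction in
theorem exists_bounded_solution {q : ℝ → ℝ} (hq : Measurable q)
    (hmom : ∀ a : ℝ, IntegrableOn (fun t => (1 + |t|) * |q t|) (Set.Ioi a))
    {D : ℝ → ℝ → ℝ → ℝ → ℝ}
    (hD : Continuous fun p : ℝ × ℝ × ℝ × ℝ => D p.1 p.2.1 p.2.2.1 p.2.2.2)
    {M : ℝ} (hDbd : ∀ x y t s, |D x y t s| ≤ M)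
    {w : ℝ → ℝ} (hwc : Continuous w) (hwa : Antitone w) (hw1 : ∀ x, 1 ≤ w x)
    (hwq : ∀ x, ∫ y in Set.Ioi x, 4 * M * |q y| ≤ w x)
    (hwi : ∀ x, ∫ y in Set.Ioi x, 4 * M * |q y| * ((y - x) * w y) ≤ w x / 2) :
    ∃ (K : ℝ → ℝ → ℝ) (b : ℝ), (Continuous fun p : ℝ × ℝ => K p.1 p.2) ∧
      (∀ x s, |K x s| ≤ b * w x) ∧
      ∀ x s, x ≤ s → K x s = -2 * (∫ y in Set.Ioi ((x + s) / 2), q y * D x y y s)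
        - 2 * ∫ y in Set.Ioi x, q y * innerInt D K x s y := by
  have hM : 0 ≤ M := (abs_nonneg _).trans (hDbd 0 0 0 0)
  have hw0 : ∀ x, 0 < w x := fun x => zero_lt_one.trans_le (hw1 x)
  let N : ((ℝ × ℝ) →ᵇ ℝ) → ℝ → ℝ → ℝ := fun f y t => w y * f (y, t)
  have hNc : ∀ f, Continuous fun p : ℝ × ℝ => N f p.1 p.2 := fun f =>
    (hwc.comp continuous_fst).mul f.continuous
  have hNb : ∀ f y t, |N f y t| ≤ ‖f‖ * w y := fun f y t => by
    rw [abs_mul, abs_of_pos (hw0 y), mul_comm]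
    exact mul_le_mul_of_nonneg_right (f.norm_coe_le_norm _) (hw0 y).le
  have hNb' : ∀ f x y t, x ≤ y → y ≤ t → |N f y t| ≤ ‖f‖ * w x := fun f x y t hxy _ =>
    (hNb f y t).trans (mul_le_mul_of_nonneg_left (hwa hxy) (norm_nonneg _))
  let A : ℝ → ℝ → ℝ := fun x s => ∫ y in Set.Ioi ((x + s) / 2), q y * D x y y s
  let B : ((ℝ × ℝ) →ᵇ ℝ) → ℝ → ℝ → ℝ := fun f x s =>
    ∫ y in Set.Ioi x, q y * innerInt D (N f) x s y
  have hA : ∀ x s, x ≤ s → |2 * A x s| ≤ w x := fun x s hxs => by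
    have h1 := abs_source_le hq hmom hDbd x s
    have h2 := mul_le_mul_of_nonneg_left
      (antitone_Qfun hq hmom (show 2 * x ≤ x + s by linarith)) hM
    have h3 := hwq x
    rw [integral_const_mul] at h3
    have h4 : Qfun q (2 * x) = ∫ y in Set.Ioi x, |q y| := by
      rw [Qfun, mul_div_cancel_left₀ x two_ne_zero]
    have h5 := mul_nonneg hM (Qfun_nonneg q (2 * x))
    rw [← h4] at h3
    rw [abs_mul, abs_two]
    linarith
  have hB : ∀ f x s, x ≤ s → |2 * B f x s| ≤ ‖f‖ * w x / 2 := fun f x s hxs =>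
    abs_integral_mul_innerInt_le hq hmom hDbd hwc hwa hw1 hwi hxs fun y t _ _ _ => hNb f y t
  have hBsub : ∀ f g x s, x ≤ s → B f x s - B g x s = B (f - g) x s := fun f g x s hxs => by
    refine (integral_mul_innerInt_sub hq hmom hD hDbd (hNc f) (hNc g) hxs (hNb' f x)
      (hNb' g x)).symm.trans ?_
    have : (fun y t => N f y t - N g y t) = N (f - g) := by
      funext y t
      simp only [N, BoundedContinuousFunction.coe_sub, Pi.sub_apply]
      ring
    rw [this]
  let T : ((ℝ × ℝ) →ᵇ ℝ) → ((ℝ × ℝ) →ᵇ ℝ) := fun f =>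
    BoundedContinuousFunction.ofNormedAddCommGroup
      (fun p => (-2 * A p.1 (max p.1 p.2) - 2 * B f p.1 (max p.1 p.2)) / w p.1)
      (by
        refine Continuous.div (Continuous.sub (continuous_const.mul ?_) (continuous_const.mul ?_))
          (hwc.comp continuous_fst) fun p => (hw0 p.1).ne'
        · exact (continuous_source hq hmom hD hDbd).comp
            (f := fun p : ℝ × ℝ => (p.1, max p.1 p.2)) (by fun_prop)
        · exact continuous_integral_mul_innerInt hq hmom hD hDbd (hNc f)
            (hwa.const_mul (norm_nonneg f)) (hNb f))
      (1 + ‖f‖ / 2)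
      (fun p => by
        rw [Real.norm_eq_abs, abs_div, abs_of_pos (hw0 p.1), div_le_iff₀ (hw0 p.1)]
        have h1 := abs_le.1 (hA p.1 (max p.1 p.2) (le_max_left _ _))
        have h2 := abs_le.1 (hB f p.1 (max p.1 p.2) (le_max_left _ _))
        rw [abs_le]
        constructor <;> linarith)
  have hT : ContractingWith (1 / 2) T := by
    refine ⟨by rw [← NNReal.coe_lt_coe]; norm_num, LipschitzWith.of_dist_le_mul fun f g => ?_⟩
    refine (BoundedContinuousFunction.dist_le (by positivity)).2 fun p => ?_
    have h1 := hB (f - g) p.1 (max p.1 p.2) (le_max_left _ _)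
    rw [← hBsub f g _ _ (le_max_left _ _), ← dist_eq_norm] at h1
    have h2 : T f p - T g p =
        -(2 * (B f p.1 (max p.1 p.2) - B g p.1 (max p.1 p.2))) / w p.1 := by
      simp only [T, BoundedContinuousFunction.coe_ofNormedAddCommGroup]
      ring
    rw [Real.dist_eq, h2, abs_div, abs_neg, abs_of_pos (hw0 p.1), div_le_iff₀ (hw0 p.1)]
    push_cast
    linarith
  obtain ⟨f, hf⟩ : ∃ f, T f = f := ⟨_, hT.fixedPoint_isFixedPt⟩
  refine ⟨N f, ‖f‖, hNc f, hNb f, fun x s hxs => ?_⟩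
  have h : f (x, s) = (-2 * A x (max x s) - 2 * B f x (max x s)) / w x :=
    (DFunLike.congr_fun hf (x, s)).symm
  rw [max_eq_right hxs] at h
  simp only [N, h]
  exact mul_div_cancel₀ _ (hw0 x).ne'

end TransformationKernel

/-- Lemma A.1 together with estimate (A.21) of Lemma A.2: the integral equation (A.15)
for the transformation-operator kernel has a unique continuous bounded solution `K` on
`{(x,s) : s ≥ x}`, satisfying `|K(x,s)| ≤ C(x)·Q(x+s)`. -/
theorem transformation_kernel_exists_unique
    (q : ℝ → ℝ) (hq : Measurable q)
    (hmom : ∀ a : ℝ, IntegrableOn (fun t => (1 + |t|) * |q t|) (Set.Ioi a))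
    (D : ℝ → ℝ → ℝ → ℝ → ℝ)
    (hD : Continuous fun p : ℝ × ℝ × ℝ × ℝ => D p.1 p.2.1 p.2.2.1 p.2.2.2)
    (M : ℝ) (hDbd : ∀ x y t s, |D x y t s| ≤ M) :
    ∃ K : ℝ → ℝ → ℝ,
      ContinuousOn (fun p : ℝ × ℝ => K p.1 p.2) {p : ℝ × ℝ | p.1 ≤ p.2} ∧
      (∀ x s : ℝ, x ≤ s →
        K x s = -2 * (∫ y in Set.Ioi ((x + s) / 2), q y * D x y y s)
          - 2 * ∫ y in Set.Ioi x, q y *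
              ∫ t in (s + x - y)..(s + y - x), D x y t s * (if y ≤ t then K y t else 0)) ∧
      (∃ C : ℝ → ℝ, Continuous C ∧ (∀ x, 0 < C x) ∧ Antitone C ∧
        ∀ x s : ℝ, x ≤ s → |K x s| ≤ C x * Qfun q (x + s)) ∧
      (∀ K' : ℝ → ℝ → ℝ,
        ContinuousOn (fun p : ℝ × ℝ => K' p.1 p.2) {p : ℝ × ℝ | p.1 ≤ p.2} →
        (∀ a : ℝ, ∃ M' : ℝ, ∀ x s : ℝ, a ≤ x → x ≤ s → |K' x s| ≤ M') →
        (∀ x s : ℝ, x ≤ s →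
          K' x s = -2 * (∫ y in Set.Ioi ((x + s) / 2), q y * D x y y s)
            - 2 * ∫ y in Set.Ioi x, q y *
                ∫ t in (s + x - y)..(s + y - x), D x y t s * (if y ≤ t then K' y t else 0)) →
        ∀ x s : ℝ, x ≤ s → K' x s = K x s) := by
  have hM : 0 ≤ M := (abs_nonneg _).trans (hDbd 0 0 0 0)
  obtain ⟨w, hwc, hwa, hw1, hwq, hwi⟩ := exists_weight (g := fun y => 4 * M * |q y|)
    (hq.abs.const_mul _) (fun y => by positivity) fun a => by
      refine ((hmom a).const_mul (4 * M)).congr (Eventually.of_forall fun t => ?_)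
      simp only [abs_mul, abs_abs, abs_of_nonneg hM, abs_of_pos (four_pos : (0 : ℝ) < 4)]
      ring
  obtain ⟨K, b, hKc, hKb, hK⟩ := exists_bounded_solution hq hmom hD hDbd hwc hwa hw1 hwq hwi
  have hw0 : ∀ x, 0 < w x := fun x => zero_lt_one.trans_le (hw1 x)
  have hinner : ∀ (L L' : ℝ → ℝ → ℝ), (∀ y t, y ≤ t → L y t = L' y t) → ∀ x s : ℝ, x ≤ s →
      ∫ y in Set.Ioi x, q y *
        ∫ t in (s + x - y)..(s + y - x), D x y t s * (if y ≤ t then L y t else 0) =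
      ∫ y in Set.Ioi x, q y * innerInt D L' x s y := fun L L' hL x s hxs =>
    setIntegral_congr_fun measurableSet_Ioi fun y hy => by
      simp only [integral_ite_eq_innerInt D hxs (le_of_lt hy) (hL y)]
  refine ⟨K, hKc.continuousOn, fun x s hxs => ?_, ⟨fun x => (2 * (2 * M) + 1) * w x,
    by fun_prop, fun x => mul_pos (by positivity) (hw0 x), hwa.const_mul (by positivity),
    fun x s hxs => ?_⟩, fun K' hK'c hK'b hK' x s hxs => ?_⟩
  · rw [hinner K K (fun _ _ _ => rfl) x s hxs]
    exact hK x s hxs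
  · have h := abs_le_of_abs_le_add_integral hq hmom hDbd hwc hwa hw1 hwi (a := x)
      (c := 2 * M) (by positivity) (fun x s _ _ => hKb x s) (fun x s _ hxs => by
        rw [hK x s hxs]
        refine (abs_sub _ _).trans (add_le_add_left ?_ _)
        rw [abs_mul, abs_neg, abs_two]
        linarith [abs_source_le hq hmom hDbd x s]) le_rfl hxs
    refine h.trans (mul_le_mul_of_nonneg_right ?_ (Qfun_nonneg _ _))
    exact mul_le_mul_of_nonneg_right (by linarith) (hw0 x).le
  · let L : ℝ → ℝ → ℝ := fun y t => K' y (max y t)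
    have hLK' : ∀ y t, y ≤ t → K' y t = L y t := fun y t h => by simp only [L, max_eq_right h]
    have hLc : Continuous fun p : ℝ × ℝ => L p.1 p.2 :=
      hK'c.comp_continuous (f := fun p : ℝ × ℝ => (p.1, max p.1 p.2)) (by fun_prop)
        fun p => le_max_left p.1 p.2
    obtain ⟨M', hM'⟩ := hK'b x
    have hLb : ∀ y t, x ≤ y → y ≤ t → |L y t| ≤ M' := fun y t hxy _ =>
      hM' y _ hxy (le_max_left _ _)
    have hM'0 : 0 ≤ M' := (abs_nonneg _).trans (hLb x x le_rfl le_rfl)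
    have hb0 : 0 ≤ b := nonneg_of_mul_nonneg_left ((abs_nonneg _).trans (hKb 0 0)) (hw0 0)
    have h := abs_le_of_abs_le_add_integral hq hmom hDbd hwc hwa hw1 hwi (a := x)
      (c := 0) (b := M' + b) (K := fun y t => L y t - K y t) le_rfl (fun y t hxy hyt => by
        refine (abs_sub _ _).trans ?_
        have h1 := hLb y t hxy hyt
        have h2 := hKb y t
        nlinarith [mul_le_mul_of_nonneg_left (hw1 y) hM'0]) (fun y t hxy hyt => by
        rw [integral_mul_innerInt_sub hq hmom hD hDbd hLc hKc hyt
          (fun y' t' h h' => hLb y' t' (hxy.trans h) h')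
          (fun y' t' h _ => (hKb y' t').trans (mul_le_mul_of_nonneg_left (hwa h) hb0)),
          ← hLK' y t hyt, hK' y t hyt, hK y t hyt, hinner K' L hLK' y t hyt, zero_mul, zero_add,
          ← abs_neg]
        refine le_of_eq (congrArg _ ?_)
        ring) le_rfl hxs
    rw [mul_zero, zero_mul, zero_mul] at h
    rw [hLK' x s hxs]
    exact sub_eq_zero.1 (abs_nonpos_iff.1 h)
end

section
/- Let q : ℝ → ℝ be continuous with ∫_a^∞ (1+|t|)·|q(t)| dt < ∞ for every a ∈ ℝ, set Q(x) = ∫_{x/2}^∞ |q(t)| dt, and let D : ℝ⁴ → ℝ be continuous and bounded with continuous bounded first-order partial derivatives in all four variables. Let K be the continuous solution on {(x,s) : s ≥ x} of the integral equation K(x,s) = −2·∫_{(x+s)/2}^∞ q(y)·D(x,y,y,s) dy − 2·∫_x^∞ q(y)·( ∫_{s+x−y}^{s+y−x} D(x,y,t,s)·K(y,t) dt ) dy (with K(y,t) := 0 for t < y) satisfying |K(x,s)| ≤ C₀(x)·Q(x+s) for some positive continuous nonincreasing C₀. Then K has first-order partial derivatives with respect to both variables, and there exists a positive continuous nonincreasing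 function C : ℝ → ℝ such that |∂K/∂x (x,s)| + |∂K/∂s (x,s)| ≤ C(x)·( |q((x+s)/2)| + Q(x+s) ) for all s ≥ x. -/
open MeasureTheory Filter

/-- Only continuity of the integrand is needed, since the interval shrinks to a point. -/
theorem hasDerivAt_integral_shrinking {f : ℝ → ℝ → ℝ} (hf : Continuous (Function.uncurry f))
    {b : ℝ → ℝ} {b' u₀ : ℝ} (hb : HasDerivAt b b' u₀) :
    HasDerivAt (fun u => ∫ t in (b u₀)..(b u), f u t) (b' * f u₀ (b u₀)) u₀ := by
  have hfu : ∀ u, Continuous (f u) := fun u => hf.comp (by fun_prop : Continuous fun t => (u, t))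
  have key : (fun u => ∫ t in (b u₀)..(b u), (f u t - f u₀ (b u₀)))
      =o[nhds u₀] fun u => b u - b u₀ := by
    rw [Asymptotics.isLittleO_iff]
    intro ε hε
    have hc := hf.continuousAt (x := (u₀, b u₀))
    rw [Metric.continuousAt_iff] at hc
    obtain ⟨δ, hδ, hc⟩ := hc ε hε
    have h1 : ∀ᶠ u in nhds u₀, dist (b u) (b u₀) < δ :=
      hb.continuousAt.eventually (Metric.ball_mem_nhds _ hδ)
    filter_upwards [h1, Metric.ball_mem_nhds u₀ hδ] with u hu hu'
    rw [Real.norm_eq_abs (b u - b u₀)]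
    refine intervalIntegral.norm_integral_le_of_norm_le_const fun t ht => ?_
    have htd : dist t (b u₀) < δ := by
      rw [Real.dist_eq] at hu ⊢
      have := Set.abs_sub_left_of_mem_uIcc (Set.uIoc_subset_uIcc ht)
      linarith
    have := hc (x := (u, t)) (by rw [Prod.dist_eq]; exact max_lt hu' htd)
    rw [Real.dist_eq] at this
    exact this.le
  have key2 := key.trans_isBigO hb.isBigO_sub
  rw [hasDerivAt_iff_isLittleO] at hb ⊢
  refine (key2.add (hb.const_mul_left (f u₀ (b u₀)))).congr_left fun u => ?_
  rw [intervalIntegral.integral_sub ((hfu u).intervalIntegrable _ _)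
    (continuous_const.intervalIntegrable _ _)]
  simp only [intervalIntegral.integral_const, intervalIntegral.integral_same, smul_eq_mul]
  ring

/-- Leibniz rule for an interval integral with moving endpoints. -/
theorem hasDerivAt_integral_moving_endpoints {f f' : ℝ → ℝ → ℝ}
    (hf : Continuous (Function.uncurry f)) {u₀ : ℝ} (hf' : Continuous (f' u₀)) {N : ℝ}
    (hN : ∀ u t, |f' u t| ≤ N) (hd : ∀ u t, HasDerivAt (fun v => f v t) (f' u t) u)
    {a b : ℝ → ℝ} {a' b' : ℝ} (ha : HasDerivAt a a' u₀) (hb : HasDerivAt b b' u₀) :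
    HasDerivAt (fun u => ∫ t in (a u)..(b u), f u t)
      (b' * f u₀ (b u₀) - a' * f u₀ (a u₀) + ∫ t in (a u₀)..(b u₀), f' u₀ t) u₀ := by
  have hfu : ∀ u, Continuous (f u) := fun u => hf.comp (by fun_prop : Continuous fun t => (u, t))
  have h := (intervalIntegral.hasDerivAt_integral_of_dominated_loc_of_deriv_le
    (μ := volume) (a := a u₀) (b := b u₀) (F := f) (F' := f') (x₀ := u₀) (bound := fun _ => N)
    (s := Set.univ) Filter.univ_mem
    (Filter.Eventually.of_forall fun u => (hfu u).aestronglyMeasurable)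
    ((hfu u₀).intervalIntegrable _ _) hf'.aestronglyMeasurable
    (Filter.Eventually.of_forall fun t _ u _ => hN u t)
    (continuous_const.intervalIntegrable _ _)
    (Filter.Eventually.of_forall fun t _ u _ => hd u t)).2
  refine (((hasDerivAt_integral_shrinking hf hb).sub
    (hasDerivAt_integral_shrinking hf ha)).add h).congr_of_eventuallyEq
      (Filter.Eventually.of_forall fun u => ?_)
  have hi : ∀ c d, IntervalIntegrable (f u) volume c d := fun c d => (hfu u).intervalIntegrable c d
  simp only [Pi.add_apply, Pi.sub_apply]
  have h1 := intervalIntegral.integral_add_adjacent_intervals (hi (a u₀) (a u)) (hi (a u) (b u))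
  have h2 := intervalIntegral.integral_add_adjacent_intervals (hi (a u₀) (b u₀)) (hi (b u₀) (b u))
  linarith

/-- Leibniz rule for an integral over a half-line with moving endpoint. -/
theorem hasDerivAt_integral_Ioi_moving {h h' : ℝ → ℝ → ℝ}
    (hcont : Continuous (Function.uncurry h)) {c : ℝ → ℝ} {c' u₀ : ℝ} (hc : HasDerivAt c c' u₀)
    (hint : ∀ u a, IntegrableOn (h u) (Set.Ioi a)) (hmeas : Continuous (h' u₀))
    {bound : ℝ → ℝ} (hbound : IntegrableOn bound (Set.Ioi (c u₀)))
    (hle : ∀ u ∈ Metric.ball u₀ 1, ∀ y ∈ Set.Ioi (c u₀), |h' u y| ≤ bound y)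
    (hd : ∀ u y, HasDerivAt (fun v => h v y) (h' u y) u) :
    HasDerivAt (fun u => ∫ y in Set.Ioi (c u), h u y)
      ((∫ y in Set.Ioi (c u₀), h' u₀ y) - c' * h u₀ (c u₀)) u₀ := by
  have hu : ∀ u, Continuous (h u) := fun u => hcont.comp (by fun_prop : Continuous fun t => (u, t))
  have hfix := (hasDerivAt_integral_of_dominated_loc_of_deriv_le
    (μ := volume.restrict (Set.Ioi (c u₀))) (F := h) (F' := h') (x₀ := u₀) (bound := bound)
    (Metric.ball_mem_nhds u₀ one_pos)
    (Filter.Eventually.of_forall fun u => (hu u).aestronglyMeasurable)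
    (hint _ _) hmeas.aestronglyMeasurable
    ((ae_restrict_iff' measurableSet_Ioi).2
      (Filter.Eventually.of_forall fun y hy u hu => hle u hu y hy))
    hbound (Filter.Eventually.of_forall fun y u _ => hd u y)).2
  refine (hfix.sub (hasDerivAt_integral_shrinking hcont hc)).congr_of_eventuallyEq
    (Filter.Eventually.of_forall fun u => ?_)
  have := intervalIntegral.integral_interval_add_Ioi' ((hu u).intervalIntegrable (c u₀) (c u))
    (hint u (c u))
  simp only [Pi.sub_apply]
  linarith

theorem integrableOn_mul_of_linear_growth {q φ : ℝ → ℝ} (hq : Continuous q) (hφ : Continuous φ)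
    {a R : ℝ} (hmom : IntegrableOn (fun t => (1 + |t|) * |q t|) (Set.Ioi a))
    (hR : ∀ y ∈ Set.Ioi a, |φ y| ≤ R * (1 + |y|)) :
    IntegrableOn (fun y => q y * φ y) (Set.Ioi a) := by
  refine Integrable.mono' (hmom.const_mul R) (hq.mul hφ).aestronglyMeasurable
    ((ae_restrict_iff' measurableSet_Ioi).2 (Eventually.of_forall fun y hy => ?_))
  rw [Real.norm_eq_abs, abs_mul]
  nlinarith [hR y hy, abs_nonneg (q y)]

/-- The `y`-integrand of the double integral, without the factor `q y`. -/
noncomputable def sliceIntegral (κ : ℝ → ℝ → ℝ) (E : ℝ → ℝ → ℝ → ℝ) (α₀ α₁ β₀ β₁ u y : ℝ) : ℝ :=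
  ∫ t in (α₀ + α₁ * u - y)..(y + (β₀ + β₁ * u)), E u y t * κ y t

/-- The `u`-derivative of `sliceIntegral κ E`, when `E'` is the `u`-derivative of `E`. -/
noncomputable def sliceIntegralDeriv (κ : ℝ → ℝ → ℝ) (E E' : ℝ → ℝ → ℝ → ℝ)
    (α₀ α₁ β₀ β₁ u y : ℝ) : ℝ :=
  β₁ * (E u y (y + (β₀ + β₁ * u)) * κ y (y + (β₀ + β₁ * u)))
    - α₁ * (E u y (α₀ + α₁ * u - y) * κ y (α₀ + α₁ * u - y))
    + sliceIntegral κ E' α₀ α₁ β₀ β₁ u y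

theorem continuous_sliceIntegral {κ : ℝ → ℝ → ℝ} (hκ : Continuous (Function.uncurry κ))
    {E : ℝ → ℝ → ℝ → ℝ} (hE : Continuous fun p : ℝ × ℝ × ℝ => E p.1 p.2.1 p.2.2)
    (α₀ α₁ β₀ β₁ : ℝ) :
    Continuous fun p : ℝ × ℝ => sliceIntegral κ E α₀ α₁ β₀ β₁ p.1 p.2 := by
  have hf : Continuous (Function.uncurry fun (p : ℝ × ℝ) (t : ℝ) => E p.1 p.2 t * κ p.2 t) :=
    (hE.comp (by fun_prop : Continuous fun r : (ℝ × ℝ) × ℝ => (r.1.1, r.1.2, r.2))).mul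
      (hκ.comp (by fun_prop : Continuous fun r : (ℝ × ℝ) × ℝ => (r.1.2, r.2)))
  have hfp : ∀ p : ℝ × ℝ, Continuous fun t => E p.1 p.2 t * κ p.2 t := fun p =>
    hf.comp (by fun_prop : Continuous fun t => (p, t))
  have h1 := intervalIntegral.continuous_parametric_intervalIntegral_of_continuous (μ := volume)
    (a₀ := 0) hf (s := fun p => p.2 + (β₀ + β₁ * p.1)) (by fun_prop)
  have h2 := intervalIntegral.continuous_parametric_intervalIntegral_of_continuous (μ := volume)
    (a₀ := 0) hf (s := fun p => α₀ + α₁ * p.1 - p.2) (by fun_prop)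
  refine (h1.sub h2).congr fun p => ?_
  exact intervalIntegral.integral_interval_sub_left ((hfp p).intervalIntegrable _ _)
    ((hfp p).intervalIntegrable _ _)

theorem continuous_sliceIntegralDeriv {κ : ℝ → ℝ → ℝ} (hκ : Continuous (Function.uncurry κ))
    {E E' : ℝ → ℝ → ℝ → ℝ} (hE : Continuous fun p : ℝ × ℝ × ℝ => E p.1 p.2.1 p.2.2)
    (hE' : Continuous fun p : ℝ × ℝ × ℝ => E' p.1 p.2.1 p.2.2) (α₀ α₁ β₀ β₁ u : ℝ) :
    Continuous (sliceIntegralDeriv κ E E' α₀ α₁ β₀ β₁ u) := by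
  have h1 : ∀ φ : ℝ → ℝ, Continuous φ → Continuous fun y => E u y (φ y) * κ y (φ y) := fun φ hφ =>
    (hE.comp (by fun_prop : Continuous fun y => (u, y, φ y))).mul
      (hκ.comp (by fun_prop : Continuous fun y => (y, φ y)))
  exact ((continuous_const.mul (h1 _ (by fun_prop))).sub
    (continuous_const.mul (h1 _ (by fun_prop)))).add
      ((continuous_sliceIntegral hκ hE' α₀ α₁ β₀ β₁).comp
        (by fun_prop : Continuous fun y => (u, y)))

theorem abs_sliceIntegral_le {κ : ℝ → ℝ → ℝ} {E : ℝ → ℝ → ℝ → ℝ} {M B α₀ α₁ β₀ β₁ u y : ℝ}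
    (hM : ∀ t, |E u y t| ≤ M)
    (hB : ∀ t ∈ Set.uIcc (α₀ + α₁ * u - y) (y + (β₀ + β₁ * u)), |κ y t| ≤ B) :
    |sliceIntegral κ E α₀ α₁ β₀ β₁ u y|
      ≤ M * B * |y + (β₀ + β₁ * u) - (α₀ + α₁ * u - y)| := by
  rw [sliceIntegral, ← Real.norm_eq_abs]
  refine intervalIntegral.norm_integral_le_of_norm_le_const fun t ht => ?_
  rw [Real.norm_eq_abs, abs_mul]
  exact mul_le_mul (hM t) (hB t (Set.uIoc_subset_uIcc ht)) (abs_nonneg _)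
    ((abs_nonneg _).trans (hM t))

theorem abs_sliceIntegralDeriv_le {κ : ℝ → ℝ → ℝ} {E E' : ℝ → ℝ → ℝ → ℝ}
    {M B α₀ α₁ β₀ β₁ u y : ℝ} (hM : ∀ t, |E u y t| ≤ M) (hM' : ∀ t, |E' u y t| ≤ M)
    (hB : ∀ t ∈ Set.uIcc (α₀ + α₁ * u - y) (y + (β₀ + β₁ * u)), |κ y t| ≤ B) :
    |sliceIntegralDeriv κ E E' α₀ α₁ β₀ β₁ u y|
      ≤ M * B * (|β₁| + |α₁| + |y + (β₀ + β₁ * u) - (α₀ + α₁ * u - y)|) := by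
  have h1 : ∀ γ : ℝ, ∀ t ∈ Set.uIcc (α₀ + α₁ * u - y) (y + (β₀ + β₁ * u)),
      |γ * (E u y t * κ y t)| ≤ M * B * |γ| := fun γ t ht => by
    rw [abs_mul, abs_mul, mul_comm (M * B)]
    exact mul_le_mul_of_nonneg_left (mul_le_mul (hM t) (hB t ht) (abs_nonneg _)
      ((abs_nonneg _).trans (hM t))) (abs_nonneg _)
  have h2 := abs_sliceIntegral_le (α₀ := α₀) (α₁ := α₁) (β₀ := β₀) (β₁ := β₁) hM' hB
  have h3 := h1 β₁ _ Set.right_mem_uIcc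
  have h4 := h1 α₁ _ Set.left_mem_uIcc
  refine (abs_add_le _ _).trans ?_
  refine (add_le_add ((abs_sub _ _).trans (add_le_add h3 h4)) h2).trans (le_of_eq (by ring))

theorem integrableOn_mul_sliceIntegral {q : ℝ → ℝ} (hq : Continuous q)
    (hmom : ∀ a : ℝ, IntegrableOn (fun t => (1 + |t|) * |q t|) (Set.Ioi a))
    {κ : ℝ → ℝ → ℝ} (hκ : Continuous (Function.uncurry κ))
    (hκb : ∀ a, ∃ B, ∀ y, a ≤ y → ∀ t, |κ y t| ≤ B)
    {E : ℝ → ℝ → ℝ → ℝ} (hE : Continuous fun p : ℝ × ℝ × ℝ => E p.1 p.2.1 p.2.2)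
    {M : ℝ} (hM : ∀ u y t, |E u y t| ≤ M) (α₀ α₁ β₀ β₁ u a : ℝ) :
    IntegrableOn (fun y => q y * sliceIntegral κ E α₀ α₁ β₀ β₁ u y) (Set.Ioi a) := by
  obtain ⟨B, hB⟩ := hκb a
  have hM0 : 0 ≤ M := (abs_nonneg _).trans (hM 0 0 0)
  have hB0 : 0 ≤ B := (abs_nonneg _).trans (hB a le_rfl 0)
  refine integrableOn_mul_of_linear_growth hq ((continuous_sliceIntegral hκ hE α₀ α₁ β₀ β₁).comp
    (by fun_prop : Continuous fun y => (u, y))) (hmom a)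
    (R := M * B * (2 + |β₀ + β₁ * u - (α₀ + α₁ * u)|)) fun y hy => ?_
  refine (abs_sliceIntegral_le (hM u y) fun t _ => hB y (le_of_lt hy) t).trans ?_
  rw [mul_assoc (M * B)]
  refine mul_le_mul_of_nonneg_left ?_ (mul_nonneg hM0 hB0)
  have : |y + (β₀ + β₁ * u) - (α₀ + α₁ * u - y)|
      ≤ |2 * y| + |β₀ + β₁ * u - (α₀ + α₁ * u)| := by
    refine le_trans (le_of_eq ?_) (abs_add_le _ _)
    congr 1; ring
  rw [abs_mul, abs_two] at this
  nlinarith [abs_nonneg y, abs_nonneg (β₀ + β₁ * u - (α₀ + α₁ * u))]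

/-- The boundary term of the Leibniz rule vanishes, since the inner interval is degenerate at the
endpoint of the half-line. -/
theorem hasDerivAt_integral_mul_sliceIntegral {q : ℝ → ℝ} (hq : Continuous q)
    (hmom : ∀ a : ℝ, IntegrableOn (fun t => (1 + |t|) * |q t|) (Set.Ioi a))
    {κ : ℝ → ℝ → ℝ} (hκ : Continuous (Function.uncurry κ))
    (hκb : ∀ a, ∃ B, ∀ y, a ≤ y → ∀ t, |κ y t| ≤ B)
    {E E' : ℝ → ℝ → ℝ → ℝ} (hE : Continuous fun p : ℝ × ℝ × ℝ => E p.1 p.2.1 p.2.2)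
    (hE' : Continuous fun p : ℝ × ℝ × ℝ => E' p.1 p.2.1 p.2.2)
    {M : ℝ} (hM : ∀ u y t, |E u y t| ≤ M) (hM' : ∀ u y t, |E' u y t| ≤ M)
    (hd : ∀ u y t, HasDerivAt (fun v => E v y t) (E' u y t) u) (α₀ α₁ β₀ β₁ u₀ : ℝ) :
    HasDerivAt (fun u => ∫ y in Set.Ioi ((α₀ + α₁ * u - (β₀ + β₁ * u)) / 2),
        q y * sliceIntegral κ E α₀ α₁ β₀ β₁ u y)
      (∫ y in Set.Ioi ((α₀ + α₁ * u₀ - (β₀ + β₁ * u₀)) / 2),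
        q y * sliceIntegralDeriv κ E E' α₀ α₁ β₀ β₁ u₀ y) u₀ := by
  have hlin : ∀ γ₀ γ₁ u : ℝ, HasDerivAt (fun v => γ₀ + γ₁ * v) γ₁ u := fun γ₀ γ₁ u => by
    simpa using ((hasDerivAt_id u).const_mul γ₁).const_add γ₀
  obtain ⟨B, hB⟩ := hκb ((α₀ + α₁ * u₀ - (β₀ + β₁ * u₀)) / 2)
  have hM0 : 0 ≤ M := (abs_nonneg _).trans (hM 0 0 0)
  have hB0 : 0 ≤ B := (abs_nonneg _).trans (hB _ le_rfl 0)
  have hslice : ∀ u y, HasDerivAt (fun v => sliceIntegral κ E α₀ α₁ β₀ β₁ v y)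
      (sliceIntegralDeriv κ E E' α₀ α₁ β₀ β₁ u y) u := fun u y => by
    obtain ⟨N, hN⟩ := hκb y
    have hκy : Continuous (κ y) := hκ.comp (by fun_prop : Continuous fun t => (y, t))
    refine hasDerivAt_integral_moving_endpoints (f := fun u t => E u y t * κ y t)
      (f' := fun u t => E' u y t * κ y t) (N := M * N) ?_ ?_ (fun u t => ?_)
      (fun u t => (hd u y t).mul_const _) ((hlin α₀ α₁ u).sub_const y)
      ((hlin β₀ β₁ u).const_add y)
    · exact (hE.comp (by fun_prop : Continuous fun r : ℝ × ℝ => (r.1, y, r.2))).mul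
        (hκy.comp continuous_snd)
    · exact (hE'.comp (by fun_prop : Continuous fun t : ℝ => (u, y, t))).mul hκy
    · rw [abs_mul]
      exact mul_le_mul (hM' u y t) (hN y le_rfl t) (abs_nonneg _) hM0
  set R : ℝ := 2 + |β₀ + β₁ * u₀ - (α₀ + α₁ * u₀)| + 2 * (|β₁| + |α₁|)
  have key := hasDerivAt_integral_Ioi_moving
    (h := fun u y => q y * sliceIntegral κ E α₀ α₁ β₀ β₁ u y)
    (h' := fun u y => q y * sliceIntegralDeriv κ E E' α₀ α₁ β₀ β₁ u y)
    ((hq.comp continuous_snd).mul (continuous_sliceIntegral hκ hE α₀ α₁ β₀ β₁))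
    (((hlin α₀ α₁ u₀).sub (hlin β₀ β₁ u₀)).div_const 2)
    (fun u a => integrableOn_mul_sliceIntegral hq hmom hκ hκb hE hM α₀ α₁ β₀ β₁ u a)
    (hq.mul (continuous_sliceIntegralDeriv hκ hE hE' α₀ α₁ β₀ β₁ u₀))
    ((hmom _).const_mul (M * B * R)) (fun u hu y hy => ?_) (fun u y => (hslice u y).const_mul _)
  · have h0 : sliceIntegral κ E α₀ α₁ β₀ β₁ u₀ ((α₀ + α₁ * u₀ - (β₀ + β₁ * u₀)) / 2) = 0 := by
      unfold sliceIntegral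
      rw [show (α₀ + α₁ * u₀ - (β₀ + β₁ * u₀)) / 2 + (β₀ + β₁ * u₀)
        = α₀ + α₁ * u₀ - (α₀ + α₁ * u₀ - (β₀ + β₁ * u₀)) / 2 by ring]
      exact intervalIntegral.integral_same
    have h1 := key.congr_deriv (g' := ∫ y in Set.Ioi ((α₀ + α₁ * u₀ - (β₀ + β₁ * u₀)) / 2),
        q y * sliceIntegralDeriv κ E E' α₀ α₁ β₀ β₁ u₀ y) (by
      simp only [Pi.sub_apply]
      rw [h0]; simp)
    exact h1
  · have hb := abs_sliceIntegralDeriv_le (α₀ := α₀) (α₁ := α₁) (β₀ := β₀) (β₁ := β₁) (hM u y)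
      (hM' u y) fun t _ => hB y (le_of_lt hy) t
    have hlen : |y + (β₀ + β₁ * u) - (α₀ + α₁ * u - y)|
        ≤ 2 * |y| + |β₀ + β₁ * u₀ - (α₀ + α₁ * u₀)| + (|β₁| + |α₁|) := by
      have e : y + (β₀ + β₁ * u) - (α₀ + α₁ * u - y)
          = 2 * y + (β₀ + β₁ * u₀ - (α₀ + α₁ * u₀)) + (β₁ - α₁) * (u - u₀) := by ring
      have h1 : |(β₁ - α₁) * (u - u₀)| ≤ |β₁| + |α₁| := by
        rw [abs_mul]
        have hu' : |u - u₀| ≤ 1 := by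
          rw [← Real.dist_eq]; exact le_of_lt hu
        nlinarith [abs_sub β₁ α₁, abs_nonneg (β₁ - α₁), abs_nonneg (u - u₀)]
      have h2 : |2 * y| = 2 * |y| := by rw [abs_mul, abs_two]
      rw [e]
      refine (abs_add_le _ _).trans (add_le_add ((abs_add_le _ _).trans ?_) h1)
      rw [h2]
    rw [abs_mul]
    have h3 : |β₁| + |α₁| + |y + (β₀ + β₁ * u) - (α₀ + α₁ * u - y)| ≤ R * (1 + |y|) := by
      nlinarith [abs_nonneg y, abs_nonneg β₁, abs_nonneg α₁,
        abs_nonneg (β₀ + β₁ * u₀ - (α₀ + α₁ * u₀)),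
        mul_nonneg (abs_nonneg β₁) (abs_nonneg y), mul_nonneg (abs_nonneg α₁) (abs_nonneg y),
        mul_nonneg (abs_nonneg (β₀ + β₁ * u₀ - (α₀ + α₁ * u₀))) (abs_nonneg y)]
    calc |q y| * |sliceIntegralDeriv κ E E' α₀ α₁ β₀ β₁ u y|
        ≤ |q y| * (M * B * (R * (1 + |y|))) :=
          mul_le_mul_of_nonneg_left (hb.trans
            (mul_le_mul_of_nonneg_left h3 (mul_nonneg hM0 hB0))) (abs_nonneg _)
      _ = M * B * R * ((1 + |y|) * |q y|) := by ring

theorem abs_setIntegral_Ioi_mul_le {q φ : ℝ → ℝ} {x a N : ℝ} (hN : 0 ≤ N)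
    (hmom : IntegrableOn (fun t => (1 + |t|) * |q t|) (Set.Ioi x)) (hxa : x ≤ a)
    (hφ : ∀ y ∈ Set.Ioi a, |φ y| ≤ N * (2 + 2 * (y - x))) :
    |∫ y in Set.Ioi a, q y * φ y|
      ≤ N * (2 * (1 + max 0 (-x))) * ∫ t in Set.Ioi x, (1 + |t|) * |q t| := by
  have hsub : Set.Ioi a ⊆ Set.Ioi x := Set.Ioi_subset_Ioi hxa
  have hm : 0 ≤ max 0 (-x) := le_max_left _ _
  rw [← integral_const_mul, ← Real.norm_eq_abs]
  have hi : IntegrableOn (fun t => N * (2 * (1 + max 0 (-x))) * ((1 + |t|) * |q t|)) (Set.Ioi x) :=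
    hmom.const_mul _
  have h0 : ∀ y, 0 ≤ N * (2 * (1 + max 0 (-x))) * ((1 + |y|) * |q y|) := fun y => by positivity
  refine le_trans (norm_integral_le_of_norm_le (hi.mono_set hsub)
    ((ae_restrict_iff' measurableSet_Ioi).2 (Eventually.of_forall fun y hy => ?_)))
    (setIntegral_mono_set hi (Eventually.of_forall h0) hsub.eventuallyLE)
  rw [Real.norm_eq_abs, abs_mul]
  have h1 : 2 + 2 * (y - x) ≤ 2 * (1 + max 0 (-x)) * (1 + |y|) := by
    nlinarith [le_abs_self y, le_max_right 0 (-x), mul_nonneg hm (abs_nonneg y)]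
  calc |q y| * |φ y| ≤ |q y| * (N * (2 * (1 + max 0 (-x)) * (1 + |y|))) :=
        mul_le_mul_of_nonneg_left ((hφ y hy).trans (mul_le_mul_of_nonneg_left h1 hN))
          (abs_nonneg _)
    _ = N * (2 * (1 + max 0 (-x))) * ((1 + |y|) * |q y|) := by ring

theorem integrableOn_abs_of_moment {q : ℝ → ℝ} (hq : Continuous q) {a : ℝ}
    (hmom : IntegrableOn (fun t => (1 + |t|) * |q t|) (Set.Ioi a)) :
    IntegrableOn (fun t => |q t|) (Set.Ioi a) := by
  refine Integrable.mono' hmom hq.abs.aestronglyMeasurable (Eventually.of_forall fun t => ?_)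
  rw [Real.norm_eq_abs, abs_abs]
  nlinarith [abs_nonneg t, abs_nonneg (q t), mul_nonneg (abs_nonneg t) (abs_nonneg (q t))]

/-- A transformation kernel along a line in the `(x, s)`-plane parametrized by `u`, with the
integral over the truncated cone written as a difference of integrals over two full cones. -/
noncomputable def kernelAlongLine (q : ℝ → ℝ) (κ : ℝ → ℝ → ℝ) (E : ℝ → ℝ → ℝ → ℝ)
    (α₀ β₀ β₁ u : ℝ) : ℝ :=
  -2 * (∫ y in Set.Ioi ((α₀ + 1 * u - (0 + 0 * u)) / 2), q y * E u y y)
    - 2 * ((∫ y in Set.Ioi ((α₀ + 1 * u - (β₀ + β₁ * u)) / 2),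
        q y * sliceIntegral κ E α₀ 1 β₀ β₁ u y)
      - ∫ y in Set.Ioi ((α₀ + 1 * u - (0 + 0 * u)) / 2), q y * sliceIntegral κ E α₀ 1 0 0 u y)

theorem exists_hasDerivAt_kernelAlongLine {q : ℝ → ℝ} (hq : Continuous q)
    (hmom : ∀ a : ℝ, IntegrableOn (fun t => (1 + |t|) * |q t|) (Set.Ioi a))
    {κ : ℝ → ℝ → ℝ} (hκ : Continuous (Function.uncurry κ))
    (hκb : ∀ a, ∃ B, ∀ y, a ≤ y → ∀ t, |κ y t| ≤ B)
    {E E' : ℝ → ℝ → ℝ → ℝ} (hE : Continuous fun p : ℝ × ℝ × ℝ => E p.1 p.2.1 p.2.2)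
    (hE' : Continuous fun p : ℝ × ℝ × ℝ => E' p.1 p.2.1 p.2.2)
    {M : ℝ} (hM : ∀ u y t, |E u y t| ≤ M) (hM' : ∀ u y t, |E' u y t| ≤ M)
    (hd : ∀ u y t, HasDerivAt (fun v => E v y t) (E' u y t) u) {α₀ β₀ β₁ u₀ x s N : ℝ}
    (hβ : |β₁| ≤ 1) (hx : β₀ + β₁ * u₀ = s - x) (hs : α₀ + u₀ = x + s) (hxs : x ≤ s)
    (hN : ∀ y t, x ≤ y → x + s ≤ y + t → |κ y t| ≤ N) :
    ∃ k, HasDerivAt (kernelAlongLine q κ E α₀ β₀ β₁) k u₀ ∧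
      |k| ≤ M * |q ((x + s) / 2)| + 2 * M * Qfun q (x + s)
        + 8 * M * N * (1 + max 0 (-x)) * ∫ t in Set.Ioi x, (1 + |t|) * |q t| := by
  have hM0 : 0 ≤ M := (abs_nonneg _).trans (hM 0 0 0)
  have hN0 : 0 ≤ N := (abs_nonneg _).trans (hN x s le_rfl le_rfl)
  have hdiag : ∀ u, Continuous fun y => E u y y := fun u =>
    hE.comp (by fun_prop : Continuous fun y => (u, y, y))
  have hdiag' : ∀ u, Continuous fun y => E' u y y := fun u =>
    hE'.comp (by fun_prop : Continuous fun y => (u, y, y))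
  have hc : HasDerivAt (fun u => (α₀ + 1 * u - (0 + 0 * u)) / 2) (1 / 2) u₀ := by
    have : HasDerivAt (fun u : ℝ => (α₀ + u) / 2) (1 / 2) u₀ :=
      ((hasDerivAt_id u₀).const_add α₀).div_const 2
    simpa using this
  have hdom : ∀ a, IntegrableOn (fun y => M * |q y|) (Set.Ioi a) := fun a =>
    (integrableOn_abs_of_moment hq (hmom a)).const_mul M
  have hqle : ∀ e y : ℝ, |e| ≤ M → |q y * e| ≤ M * |q y| := fun e y he => by
    rw [abs_mul, mul_comm]
    exact mul_le_mul_of_nonneg_right he (abs_nonneg _)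
  have h1 := hasDerivAt_integral_Ioi_moving (h := fun u y => q y * E u y y)
    (h' := fun u y => q y * E' u y y)
    ((hq.comp continuous_snd).mul
      (hE.comp (by fun_prop : Continuous fun r : ℝ × ℝ => (r.1, r.2, r.2)))) hc
    (fun u a => Integrable.mono' (hdom a) (hq.mul (hdiag u)).aestronglyMeasurable
      (Eventually.of_forall fun y => hqle _ y (hM u y y)))
    (hq.mul (hdiag' u₀)) (hdom _) (fun u _ y _ => hqle _ y (hM' u y y))
    (fun u y => (hd u y y).const_mul _)
  have h2 := hasDerivAt_integral_mul_sliceIntegral hq hmom hκ hκb hE hE' hM hM' hd α₀ 1 β₀ β₁ u₀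
  have h3 := hasDerivAt_integral_mul_sliceIntegral hq hmom hκ hκb hE hE' hM hM' hd α₀ 1 0 0 u₀
  refine ⟨_, (h1.const_mul (-2)).sub ((h2.sub h3).const_mul 2), ?_⟩
  have ec : (α₀ + 1 * u₀ - (0 + 0 * u₀)) / 2 = (x + s) / 2 := by rw [← hs]; ring
  have ex : (α₀ + 1 * u₀ - (β₀ + β₁ * u₀)) / 2 = x := by rw [hx, one_mul, hs]; ring
  rw [ec, ex]
  have hMN : 0 ≤ M * N := mul_nonneg hM0 hN0
  have b1 : |∫ y in Set.Ioi ((x + s) / 2), q y * E' u₀ y y| ≤ M * Qfun q (x + s) := by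
    rw [Qfun, ← integral_const_mul, ← Real.norm_eq_abs]
    exact norm_integral_le_of_norm_le (hdom _)
      (Eventually.of_forall fun y => hqle _ y (hM' u₀ y y))
  have b2 := abs_setIntegral_Ioi_mul_le (q := q)
    (φ := sliceIntegralDeriv κ E E' α₀ 1 β₀ β₁ u₀) hMN (hmom x) le_rfl fun y hy => by
      have hy' : x < y := hy
      have hle : α₀ + 1 * u₀ - y ≤ y + (β₀ + β₁ * u₀) := by linarith
      refine (abs_sliceIntegralDeriv_le (hM u₀ y) (hM' u₀ y) (B := N) fun t ht => ?_).trans ?_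
      · rw [Set.uIcc_of_le hle] at ht
        exact hN y t hy'.le (by linarith [ht.1])
      · refine mul_le_mul_of_nonneg_left ?_ hMN
        rw [abs_of_nonneg (sub_nonneg.2 hle), abs_one]
        linarith
  have b3 := abs_setIntegral_Ioi_mul_le (q := q) (a := (x + s) / 2)
    (φ := sliceIntegralDeriv κ E E' α₀ 1 0 0 u₀) hMN (hmom x) (by linarith) fun y hy => by
      have hy' : (x + s) / 2 < y := hy
      have hle : α₀ + 1 * u₀ - y ≤ y + (0 + 0 * u₀) := by linarith
      refine (abs_sliceIntegralDeriv_le (hM u₀ y) (hM' u₀ y) (B := N) fun t ht => ?_).trans ?_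
      · rw [Set.uIcc_of_le hle] at ht
        exact hN y t (by linarith) (by linarith [ht.1])
      · refine mul_le_mul_of_nonneg_left ?_ hMN
        rw [abs_of_nonneg (sub_nonneg.2 hle), abs_one, abs_zero]
        linarith
  have b0 := hqle _ ((x + s) / 2) (hM u₀ ((x + s) / 2) ((x + s) / 2))
  rw [abs_le] at b0 b1 b2 b3 ⊢
  constructor <;> linarith [b0.1, b0.2, b1.1, b1.2, b2.1, b2.2, b3.1, b3.2]

/-- The integral over a truncated cone is a difference of integrals over two full cones, once the
kernel is extended across the diagonal by its diagonal values. -/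
theorem integral_truncated_cone_eq {q : ℝ → ℝ} {K e : ℝ → ℝ → ℝ} {x s : ℝ} (hxs : x ≤ s)
    (he : ∀ y, Continuous (e y)) (hκ : ∀ y, Continuous fun t => K y (max y t))
    (h1 : IntegrableOn (fun y => q y * ∫ t in (s + x - y)..(s + y - x), e y t * K y (max y t))
      (Set.Ioi x))
    (h2 : IntegrableOn (fun y => q y * ∫ t in (s + x - y)..y, e y t * K y (max y t))
      (Set.Ioi ((x + s) / 2))) :
    (∫ y in Set.Ioi x, q y *
        ∫ t in (s + x - y)..(s + y - x), e y t * (if y ≤ t then K y t else 0))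
      = (∫ y in Set.Ioi x, q y * ∫ t in (s + x - y)..(s + y - x), e y t * K y (max y t))
        - ∫ y in Set.Ioi ((x + s) / 2), q y * ∫ t in (s + x - y)..y, e y t * K y (max y t) := by
  have hsub : Set.Ioi x ∩ Set.Ioi ((x + s) / 2) = Set.Ioi ((x + s) / 2) :=
    Set.inter_eq_right.2 (Set.Ioi_subset_Ioi (by linarith))
  have h2' := (integrable_indicator_iff measurableSet_Ioi).2 h2
  rw [← hsub, ← setIntegral_indicator measurableSet_Ioi,
    ← integral_sub h1 h2'.integrableOn]
  refine setIntegral_congr_fun measurableSet_Ioi fun y hy => ?_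
  have hxy : x < y := hy
  have hi : ∀ a b, IntervalIntegrable (fun t => e y t * K y (max y t)) volume a b := fun a b =>
    ((he y).mul (hκ y)).intervalIntegrable a b
  have hup : ∀ t, y ≤ t → e y t * K y (max y t) = e y t * (if y ≤ t then K y t else 0) :=
    fun t ht => by rw [max_eq_right ht, if_pos ht]
  by_cases hys : (x + s) / 2 < y
  · have hmem : y ∈ Set.Ioi ((x + s) / 2) := hys
    simp only [Set.indicator_of_mem hmem]
    have hlo : Set.EqOn (fun _ => (0 : ℝ)) (fun t => e y t * (if y ≤ t then K y t else 0))
        (Set.uIoo (s + x - y) y) := fun t ht => by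
      rw [Set.uIoo_of_le (by linarith)] at ht
      simp [not_le.2 ht.2]
    have hhi : Set.EqOn (fun t => e y t * K y (max y t))
        (fun t => e y t * (if y ≤ t then K y t else 0)) (Set.uIoo y (s + y - x)) := fun t ht => by
      rw [Set.uIoo_of_le (by linarith)] at ht
      exact hup t ht.1.le
    rw [← intervalIntegral.integral_add_adjacent_intervals
        (IntervalIntegrable.congr_uIoo (continuous_const.intervalIntegrable _ _) hlo)
        ((hi y (s + y - x)).congr_uIoo hhi),
      ← intervalIntegral.integral_congr_uIoo hlo, ← intervalIntegral.integral_congr_uIoo hhi,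
      ← intervalIntegral.integral_add_adjacent_intervals (hi (s + x - y) y) (hi y (s + y - x))]
    simp
    ring
  · have hmem : y ∉ Set.Ioi ((x + s) / 2) := hys
    simp only [Set.indicator_of_notMem hmem, sub_zero]
    congr 1
    refine (intervalIntegral.integral_congr fun t ht => ?_).symm
    rw [Set.uIcc_of_le (by linarith)] at ht
    exact hup t (by linarith [ht.1])

/-- Estimate (A.22) of Lemma A.2: the solution `K` of the integral equation (A.15) has
first-order partial derivatives in both variables, satisfying
`|∂K/∂x| + |∂K/∂s| ≤ C(x)·(|q((x+s)/2)| + Q(x+s))` on `{s ≥ x}`. -/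
theorem transformation_kernel_derivative_estimate
    (q : ℝ → ℝ) (hq : Continuous q)
    (hmom : ∀ a : ℝ, IntegrableOn (fun t => (1 + |t|) * |q t|) (Set.Ioi a))
    (D : ℝ → ℝ → ℝ → ℝ → ℝ)
    (hD : ContDiff ℝ 1 fun p : ℝ × ℝ × ℝ × ℝ => D p.1 p.2.1 p.2.2.1 p.2.2.2)
    (M : ℝ) (hDbd : ∀ x y t s, |D x y t s| ≤ M)
    (hDder : ∀ p : ℝ × ℝ × ℝ × ℝ,
      ‖fderiv ℝ (fun p : ℝ × ℝ × ℝ × ℝ => D p.1 p.2.1 p.2.2.1 p.2.2.2) p‖ ≤ M)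
    (K : ℝ → ℝ → ℝ)
    (hKcont : ContinuousOn (fun p : ℝ × ℝ => K p.1 p.2) {p : ℝ × ℝ | p.1 ≤ p.2})
    (hKeq : ∀ x s : ℝ, x ≤ s →
      K x s = -2 * (∫ y in Set.Ioi ((x + s) / 2), q y * D x y y s)
        - 2 * ∫ y in Set.Ioi x, q y *
            ∫ t in (s + x - y)..(s + y - x), D x y t s * (if y ≤ t then K y t else 0))
    (C₀ : ℝ → ℝ) (hC₀ : Continuous C₀) (hC₀pos : ∀ x, 0 < C₀ x) (hC₀anti : Antitone C₀)
    (hKbd : ∀ x s : ℝ, x ≤ s → |K x s| ≤ C₀ x * Qfun q (x + s)) :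
    ∃ K₁ K₂ : ℝ → ℝ → ℝ,
      (∀ x s : ℝ, x ≤ s →
        HasDerivWithinAt (fun x' => K x' s) (K₁ x s) (Set.Iic s) x ∧
        HasDerivWithinAt (fun s' => K x s') (K₂ x s) (Set.Ici x) s) ∧
      ∃ C : ℝ → ℝ, Continuous C ∧ (∀ x, 0 < C x) ∧ Antitone C ∧
        ∀ x s : ℝ, x ≤ s →
          |K₁ x s| + |K₂ x s| ≤ C x * (|q ((x + s) / 2)| + Qfun q (x + s)) := by

  have hext : Continuous (Function.uncurry fun y t => K y (max y t)) :=
    hKcont.comp_continuous (f := fun p : ℝ × ℝ => (p.1, max p.1 p.2)) (by fun_prop)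
      fun p => le_max_left p.1 p.2
  have hQanti : Antitone (Qfun q) := fun a b hab =>
    setIntegral_mono_set (integrableOn_abs_of_moment hq (hmom _))
      (Eventually.of_forall fun t => abs_nonneg (q t))
      (Set.Ioi_subset_Ioi (by linarith)).eventuallyLE
  have hQ0 : ∀ a, 0 ≤ Qfun q a := fun a => integral_nonneg fun t => abs_nonneg (q t)
  have hcone : ∀ x s y t, x ≤ y → x + s ≤ y + t →
      |K y (max y t)| ≤ C₀ x * Qfun q (x + s) := fun x s y t hxy hst =>
    (hKbd y (max y t) (le_max_left _ _)).trans
      (mul_le_mul (hC₀anti hxy) (hQanti (by linarith [le_max_right y t])) (hQ0 _) (hC₀pos x).le)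
  have hκb : ∀ a, ∃ B, ∀ y, a ≤ y → ∀ t, |K y (max y t)| ≤ B := fun a =>
    ⟨C₀ a * Qfun q (a + a), fun y hy t => by
      simpa using hcone a a y (max y t) hy (by linarith [le_max_left y t])⟩
  have hfd := hD.continuous_fderiv one_ne_zero
  have hDd : ∀ p : ℝ × ℝ × ℝ × ℝ, HasFDerivAt
      (fun p : ℝ × ℝ × ℝ × ℝ => D p.1 p.2.1 p.2.2.1 p.2.2.2) (fderiv ℝ
      (fun p : ℝ × ℝ × ℝ × ℝ => D p.1 p.2.1 p.2.2.1 p.2.2.2) p) p := fun p =>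
    (hD.differentiable one_ne_zero p).hasFDerivAt
  have hpart : ∀ p v : ℝ × ℝ × ℝ × ℝ, ‖v‖ ≤ 1 → |fderiv ℝ
      (fun p : ℝ × ℝ × ℝ × ℝ => D p.1 p.2.1 p.2.2.1 p.2.2.2) p v| ≤ M := fun p v hv =>
    (((fderiv ℝ _ p).le_opNorm v).trans
      (mul_le_of_le_one_right (norm_nonneg _) hv)).trans (hDder p)
  have hrepr : ∀ x s : ℝ, x ≤ s →
      K x s = kernelAlongLine q (fun y t => K y (max y t)) (fun u y t => D u y t s) s s (-1) x ∧
      K x s = kernelAlongLine q (fun y t => K y (max y t)) (fun u y t => D x y t u) x (-x) 1 s := by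
    intro x s hxs
    have hE : Continuous fun p : ℝ × ℝ × ℝ => D x p.2.1 p.2.2 s :=
      hD.continuous.comp (by fun_prop : Continuous fun p : ℝ × ℝ × ℝ => (x, p.2.1, p.2.2, s))
    have e2 : ∀ y, sliceIntegral (fun y t => K y (max y t)) (fun _ y t => D x y t s)
        (s + x) 0 (s - x) 0 0 y
        = ∫ t in (s + x - y)..(s + y - x), D x y t s * K y (max y t) := fun y => by
      unfold sliceIntegral
      congr 1 <;> ring
    have e3 : ∀ y, sliceIntegral (fun y t => K y (max y t)) (fun _ y t => D x y t s)
        (s + x) 0 0 0 0 y = ∫ t in (s + x - y)..y, D x y t s * K y (max y t) := fun y => by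
      unfold sliceIntegral
      congr 1 <;> ring
    have hcut := integral_truncated_cone_eq (q := q) (e := fun y t => D x y t s) hxs
      (fun y => hE.comp (by fun_prop : Continuous fun t : ℝ => ((0 : ℝ), y, t)))
      (fun y => hext.comp (by fun_prop : Continuous fun t : ℝ => (y, t)))
      (by
        simpa only [e2] using integrableOn_mul_sliceIntegral hq hmom hext hκb hE
          (fun _ y t => hDbd x y t s) (s + x) 0 (s - x) 0 0 x)
      (by
        simpa only [e3] using integrableOn_mul_sliceIntegral hq hmom hext hκb hE
          (fun _ y t => hDbd x y t s) (s + x) 0 0 0 0 ((x + s) / 2))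
    rw [hKeq x s hxs, hcut]
    unfold kernelAlongLine sliceIntegral
    constructor
    · rw [show (s + 1 * x - (0 + 0 * x)) / 2 = (x + s) / 2 by ring,
        show (s + 1 * x - (s + -1 * x)) / 2 = x by ring]
      simp only [show ∀ y, s + 1 * x - y = s + x - y from fun y => by ring,
        show ∀ y, y + (s + -1 * x) = s + y - x from fun y => by ring,
        show ∀ y, y + (0 + 0 * x) = y from fun y => by ring]
    · rw [show (x + 1 * s - (0 + 0 * s)) / 2 = (x + s) / 2 by ring,
        show (x + 1 * s - (-x + 1 * s)) / 2 = x by ring]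
      simp only [show ∀ y, x + 1 * s - y = s + x - y from fun y => by ring,
        show ∀ y, y + (-x + 1 * s) = s + y - x from fun y => by ring,
        show ∀ y, y + (0 + 0 * s) = y from fun y => by ring]
  set P : ℝ → ℝ := fun x => ∫ t in Set.Ioi x, (1 + |t|) * |q t|
  set S : ℝ → ℝ → ℝ := fun x s => M * |q ((x + s) / 2)| + 2 * M * Qfun q (x + s)
    + 8 * M * (C₀ x * Qfun q (x + s)) * (1 + max 0 (-x)) * P x with hS
  have hK₁ : ∀ x s : ℝ, ∃ k, x ≤ s →
      HasDerivWithinAt (fun x' => K x' s) k (Set.Iic s) x ∧ |k| ≤ S x s := by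
    intro x s
    by_cases hxs : x ≤ s
    swap
    · exact ⟨0, fun h => absurd h hxs⟩
    obtain ⟨k, hk, hkS⟩ := exists_hasDerivAt_kernelAlongLine hq hmom hext hκb
      (E := fun u y t => D u y t s)
      (E' := fun u y t => fderiv ℝ (fun p : ℝ × ℝ × ℝ × ℝ => D p.1 p.2.1 p.2.2.1 p.2.2.2)
        (u, y, t, s) (1, 0, 0, 0))
      (hD.continuous.comp
        (by fun_prop : Continuous fun p : ℝ × ℝ × ℝ => (p.1, p.2.1, p.2.2, s)))
      ((hfd.comp (by fun_prop : Continuous fun p : ℝ × ℝ × ℝ =>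
        (p.1, p.2.1, p.2.2, s))).clm_apply continuous_const)
      (fun u y t => hDbd u y t s) (fun u y t => hpart _ _ (by simp [Prod.norm_def]))
      (fun u y t => (hDd (u, y, t, s)).comp_hasDerivAt (f := fun v => (v, y, t, s)) u
        ((hasDerivAt_id u).prodMk (hasDerivAt_const u (y, t, s))))
      (α₀ := s) (β₀ := s) (β₁ := -1) (u₀ := x) (x := x) (s := s)
      (N := C₀ x * Qfun q (x + s)) (by simp) (by ring) (by ring) hxs (hcone x s)
    exact ⟨k, fun _ => ⟨hk.hasDerivWithinAt.congr (fun u hu => (hrepr u s hu).1)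
      (hrepr x s hxs).1, hkS⟩⟩
  have hK₂ : ∀ x s : ℝ, ∃ k, x ≤ s →
      HasDerivWithinAt (fun s' => K x s') k (Set.Ici x) s ∧ |k| ≤ S x s := by
    intro x s
    by_cases hxs : x ≤ s
    swap
    · exact ⟨0, fun h => absurd h hxs⟩
    obtain ⟨k, hk, hkS⟩ := exists_hasDerivAt_kernelAlongLine hq hmom hext hκb
      (E := fun u y t => D x y t u)
      (E' := fun u y t => fderiv ℝ (fun p : ℝ × ℝ × ℝ × ℝ => D p.1 p.2.1 p.2.2.1 p.2.2.2)
        (x, y, t, u) (0, 0, 0, 1))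
      (hD.continuous.comp
        (by fun_prop : Continuous fun p : ℝ × ℝ × ℝ => (x, p.2.1, p.2.2, p.1)))
      ((hfd.comp (by fun_prop : Continuous fun p : ℝ × ℝ × ℝ =>
        (x, p.2.1, p.2.2, p.1))).clm_apply continuous_const)
      (fun u y t => hDbd x y t u) (fun u y t => hpart _ _ (by simp [Prod.norm_def]))
      (fun u y t => (hDd (x, y, t, u)).comp_hasDerivAt (f := fun v => (x, y, t, v)) u
        ((hasDerivAt_const u x).prodMk ((hasDerivAt_const u y).prodMk
          ((hasDerivAt_const u t).prodMk (hasDerivAt_id u)))))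
      (α₀ := x) (β₀ := -x) (β₁ := 1) (u₀ := s) (x := x) (s := s)
      (N := C₀ x * Qfun q (x + s)) (by simp) (by ring) rfl hxs (hcone x s)
    exact ⟨k, fun _ => ⟨hk.hasDerivWithinAt.congr (fun u hu => (hrepr x u hu).2)
      (hrepr x s hxs).2, hkS⟩⟩
  choose K₁ hK₁ using hK₁
  choose K₂ hK₂ using hK₂
  have hM0 : 0 ≤ M := (abs_nonneg _).trans (hDbd 0 0 0 0)
  have hP0 : ∀ x, 0 ≤ P x := fun x => integral_nonneg fun t => by positivity
  have hPanti : Antitone P := fun a b hab =>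
    setIntegral_mono_set (hmom a) (Eventually.of_forall fun t => by positivity)
      (Set.Ioi_subset_Ioi hab).eventuallyLE
  have hPcont : Continuous P := by
    have hg : Continuous fun t => (1 + |t|) * |q t| := by fun_prop
    refine (continuous_const.sub (intervalIntegral.continuous_primitive (μ := volume)
      (fun a b => hg.intervalIntegrable a b) 0)).congr (f := fun x => P 0 - _) fun x => ?_
    rw [← intervalIntegral.integral_Ioi_sub_Ioi' (hmom 0) (hmom x), sub_sub_cancel]
  have hm : ∀ x : ℝ, 0 ≤ 1 + max 0 (-x) := fun x => by
    have := le_max_left 0 (-x)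
    linarith
  have hG : ∀ x, 0 ≤ C₀ x * ((1 + max 0 (-x)) * P x) := fun x =>
    mul_nonneg (hC₀pos x).le (mul_nonneg (hm x) (hP0 x))
  refine ⟨K₁, K₂, fun x s hxs => ⟨(hK₁ x s hxs).1, (hK₂ x s hxs).1⟩,
    fun x => 1 + 4 * M + 16 * M * (C₀ x * ((1 + max 0 (-x)) * P x)), by fun_prop, fun x => ?_,
    fun a b hab => ?_, fun x s hxs => ?_⟩
  · have := mul_nonneg hM0 (hG x)
    linarith
  · have hmab : 1 + max 0 (-b) ≤ 1 + max 0 (-a) :=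
      add_le_add_right (max_le_max le_rfl (neg_le_neg hab)) 1
    have := mul_le_mul_of_nonneg_left (mul_le_mul (hC₀anti hab)
      (mul_le_mul hmab (hPanti hab) (hP0 b) (hm a)) (mul_nonneg (hm b) (hP0 b)) (hC₀pos a).le) hM0
    linarith
  · have h1 := (hK₁ x s hxs).2
    have h2 := (hK₂ x s hxs).2
    have hq0 := abs_nonneg (q ((x + s) / 2))
    have hQx := hQ0 (x + s)
    have h3 := mul_nonneg hM0 hq0
    have h4 := mul_nonneg (mul_nonneg hM0 (hG x)) hq0
    simp only [hS] at h1 h2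
    refine (add_le_add h1 h2).trans ?_
    linarith
end

section
/- Let q : ℝ → ℝ be measurable with ∫_a^∞ (1+|t|)·|q(t)| dt < ∞ for every a ∈ ℝ, and let D : ℝ⁴ → ℝ be continuous and bounded with D(x,y,y,x) = −1/4 for all y ≥ x. If K is a continuous solution on {(x,s) : s ≥ x} of the integral equation K(x,s) = −2·∫_{(x+s)/2}^∞ q(y)·D(x,y,y,s) dy − 2·∫_x^∞ q(y)·( ∫_{s+x−y}^{s+y−x} D(x,y,t,s)·K(y,t) dt ) dy, where K(y,t) is interpreted as 0 whenever t < y, then K(x,x) = (1/2)·∫_x^∞ q(t) dt for every x ∈ ℝ. -/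
open MeasureTheory Filter

/-- Formula (A.19): if `D(x,y,y,x) = −1/4`, then the diagonal of any continuous
solution of the integral equation (A.15) is `K(x,x) = (1/2)·∫_x^∞ q(t) dt`. -/
theorem transformation_kernel_diagonal
    (q : ℝ → ℝ) (hq : Measurable q)
    (hmom : ∀ a : ℝ, IntegrableOn (fun t => (1 + |t|) * |q t|) (Set.Ioi a))
    (D : ℝ → ℝ → ℝ → ℝ → ℝ)
    (hD : Continuous fun p : ℝ × ℝ × ℝ × ℝ => D p.1 p.2.1 p.2.2.1 p.2.2.2)
    (M : ℝ) (hDbd : ∀ x y t s, |D x y t s| ≤ M)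
    (hDdiag : ∀ x y : ℝ, x ≤ y → D x y y x = -(1 / 4))
    (K : ℝ → ℝ → ℝ)
    (hKcont : ContinuousOn (fun p : ℝ × ℝ => K p.1 p.2) {p : ℝ × ℝ | p.1 ≤ p.2})
    (hKeq : ∀ x s : ℝ, x ≤ s →
      K x s = -2 * (∫ y in Set.Ioi ((x + s) / 2), q y * D x y y s)
        - 2 * ∫ y in Set.Ioi x, q y *
            ∫ t in (s + x - y)..(s + y - x), D x y t s * (if y ≤ t then K y t else 0)) :
    ∀ x : ℝ, K x x = (1 / 2) * ∫ t in Set.Ioi x, q t := by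
  intro x
  have h1 : (∫ y in Set.Ioi x, q y * D x y y x) = ∫ y in Set.Ioi x, -(1 / 4) * q y :=
    setIntegral_congr_fun measurableSet_Ioi fun y hy => by
      simp only [hDdiag x y (Set.mem_Ioi.mp hy).le, mul_comm]
  -- On the diagonal the inner range is `[2x - y, y]`, where `K y t` vanishes except at `t = y`.
  have h2 (y : ℝ) (hy : x < y) :
      (∫ t in (x + x - y)..(x + y - x), D x y t x * (if y ≤ t then K y t else 0)) = 0 := by
    refine intervalIntegral.integral_zero_ae ?_
    filter_upwards [Measure.ae_ne volume y] with t hty ht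
    rw [Set.uIoc_of_le (by linarith)] at ht
    have hlt : t < y := lt_of_le_of_ne (by linarith [ht.2]) hty
    rw [if_neg hlt.not_ge, mul_zero]
  have h3 : (∫ y in Set.Ioi x, q y *
      ∫ t in (x + x - y)..(x + y - x), D x y t x * (if y ≤ t then K y t else 0)) = 0 :=
    setIntegral_eq_zero_of_forall_eq_zero fun y hy => by rw [h2 y hy, mul_zero]
  rw [hKeq x x le_rfl, h3, add_self_div_two, h1, integral_const_mul]
  ring
end
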